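/- arXiv:2005.13269 — 11 statements merged into one kernel-verified Lean document; each statement's English description precedes it below -/
import Mathlib

section
/- Let k, m ≥ 1 be integers and set N = min{m−1, k}. Let 𝔅 = (𝔅_1, …, 𝔅_k) : ℝ^m → ℝ^k be of class C² with 𝔅(0) = 0, and assume that for every integer i with 1 ≤ i ≤ N, the i×i submatrix of the Jacobian matrix ∇𝔅(0) formed from its last i rows and its last i columns is invertible. Then there exist ε > 0 and, for each i ∈ {1, …, N}, a C² function M_i : {z ∈ ℝ^{m−i} : |z| < ε} → ℝ with M_i(0) = 0, such that for every y = (y_1, …, y_m) ∈ ℝ^m with |y| < ε and every i ∈ {1, …, N}: if y_{m−i′+1} = M_{i′}(y_1, …, y_{m−i′}) for all integers i′ with 1 ≤ i′ ≤ i, then 𝔅_{k−i′+1}(y) = 0 for all integers i′ with 1 ≤ i′ ≤ i. -/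
open Filter Topology

/-- The map replacing the last `i` coordinates of `y` by the last `i` components of `B y`. -/
def replaceTail {k m : ℕ} (B : (Fin m → ℝ) → (Fin k → ℝ)) (i : ℕ) (y : Fin m → ℝ) :
    Fin m → ℝ := fun a =>
  if h : m - i ≤ a.1 ∧ m ≤ k + a.1 then B y ⟨k + a.1 - m, by have ha := a.isLt; omega⟩ else y a

/-- Extension by zero of a vector indexed by `Fin (m - i)` to one indexed by `Fin m`. -/
def extendZero (m i : ℕ) (z : Fin (m - i) → ℝ) : Fin m → ℝ := fun a =>
  if h : a.1 < m - i then z ⟨a.1, h⟩ else 0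

theorem contDiff_extendZero (m i : ℕ) : ContDiff ℝ 2 (extendZero m i) := by
  rw [contDiff_pi]
  intro a
  unfold extendZero
  split_ifs with h
  · exact contDiff_apply ℝ ℝ _
  · exact contDiff_const

theorem norm_extendZero_le (m i : ℕ) (z : Fin (m - i) → ℝ) : ‖extendZero m i z‖ ≤ ‖z‖ := by
  rw [pi_norm_le_iff_of_nonneg (norm_nonneg _)]
  intro a
  unfold extendZero
  split_ifs with h
  · exact norm_le_pi_norm z _
  · simp

theorem extendZero_zero (m i : ℕ) : extendZero m i 0 = 0 := by
  funext a
  simp [extendZero]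

theorem replaceTail_zero {k m : ℕ} {B : (Fin m → ℝ) → (Fin k → ℝ)} (hB0 : B 0 = 0) (i : ℕ) :
    replaceTail B i 0 = 0 := by
  funext a
  simp [replaceTail, hB0]

theorem contDiff_replaceTail {k m : ℕ} {B : (Fin m → ℝ) → (Fin k → ℝ)} (hB : ContDiff ℝ 2 B)
    (i : ℕ) : ContDiff ℝ 2 (replaceTail B i) := by
  rw [contDiff_pi]
  intro a
  unfold replaceTail
  split_ifs with h
  · exact contDiff_pi.1 hB _
  · exact contDiff_apply ℝ ℝ _

theorem fderiv_replaceTail_apply {k m : ℕ} {B : (Fin m → ℝ) → (Fin k → ℝ)}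
    (hB : ContDiff ℝ 2 B) (i : ℕ) (v : Fin m → ℝ) :
    fderiv ℝ (replaceTail B i) 0 v = fun a =>
      if h : m - i ≤ a.1 ∧ m ≤ k + a.1 then
        fderiv ℝ B 0 v ⟨k + a.1 - m, by have := a.isLt; omega⟩ else v a := by
  have hd : DifferentiableAt ℝ B 0 := hB.differentiable (by norm_num) 0
  have hd' : DifferentiableAt ℝ (replaceTail B i) 0 :=
    (contDiff_replaceTail hB i).differentiable (by norm_num) 0
  funext a
  have h1 := hasFDerivAt_pi'.1 hd'.hasFDerivAt a
  have h2 := hasFDerivAt_pi'.1 hd.hasFDerivAt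
  split_ifs with h
  · have h3 : (fun x => replaceTail B i x a) =
        fun x => B x ⟨k + a.1 - m, by have := a.isLt; omega⟩ := by
      funext x
      simp [replaceTail, h]
    rw [h3] at h1
    exact DFunLike.congr_fun (h1.unique (h2 _)) v
  · have h3 : (fun x => replaceTail B i x a) = fun x => x a := by
      funext x
      simp only [replaceTail, dif_neg h]
    rw [h3] at h1
    exact DFunLike.congr_fun (h1.unique (hasFDerivAt_apply a (0 : Fin m → ℝ))) v

theorem injective_fderiv_replaceTail {k m : ℕ} {B : (Fin m → ℝ) → (Fin k → ℝ)}
    (hB : ContDiff ℝ 2 B) (i : ℕ) (hik : i ≤ k) (him : i ≤ m)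
    (hJ : IsUnit (Matrix.of (fun p q : Fin i =>
        fderiv ℝ B 0 (Pi.single ⟨m - i + q.1, by have hq := q.isLt; omega⟩ 1)
          ⟨k - i + p.1, by have hp := p.isLt; omega⟩))) :
    Function.Injective (fderiv ℝ (replaceTail B i) 0) := by
  rw [injective_iff_map_eq_zero]
  intro v hv
  rw [fderiv_replaceTail_apply hB] at hv
  have hhead : ∀ a : Fin m, a.1 < m - i → v a = 0 := by
    intro a ha
    have := congrFun hv a
    rwa [dif_neg (by omega)] at this
  set e : Fin i → Fin m := fun q => ⟨m - i + q.1, by have hq := q.isLt; omega⟩ with he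
  have hinj : Function.Injective e := by
    intro p q h
    simp only [he, Fin.mk.injEq] at h
    exact Fin.ext (by omega)
  have hsum : v = ∑ q : Fin i, v (e q) • (Pi.single (e q) 1 : Fin m → ℝ) := by
    funext a
    simp only [Finset.sum_apply, Pi.smul_apply, smul_eq_mul]
    by_cases ha : a.1 < m - i
    · rw [hhead a ha, Finset.sum_eq_zero]
      intro q _
      rw [Pi.single_eq_of_ne, mul_zero]
      intro h
      have : a.1 = m - i + q.1 := congrArg Fin.val h
      omega
    · have hai : a = e ⟨a.1 - (m - i), by have := a.isLt; omega⟩ := Fin.ext (by simp [he]; omega)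
      rw [hai, Finset.sum_eq_single ⟨a.1 - (m - i), by have := a.isLt; omega⟩]
      · simp
      · intro q _ hq
        rw [Pi.single_eq_of_ne (fun h => hq (hinj h).symm), mul_zero]
      · simp
  have hmul : Matrix.mulVec (Matrix.of (fun p q : Fin i =>
        fderiv ℝ B 0 (Pi.single (e q) 1)
          ⟨k - i + p.1, by have hp := p.isLt; omega⟩)) (fun q => v (e q)) = 0 := by
    funext p
    have h1 := congrFun hv (e p)
    rw [dif_pos (by simp only [he]; omega)] at h1
    rw [hsum, map_sum] at h1
    simp only [map_smul, Finset.sum_apply, Pi.smul_apply, smul_eq_mul] at h1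
    simp only [Matrix.mulVec, dotProduct, Matrix.of_apply, Pi.zero_apply] at h1 ⊢
    rw [← h1]
    refine Finset.sum_congr rfl fun q _ => ?_
    rw [mul_comm]
    refine congrArg (_ * ·) (congrArg (fderiv ℝ B 0 (Pi.single (e q) 1)) (Fin.ext ?_))
    have hp := p.isLt
    simp only [he]
    omega
  have htail := Matrix.mulVec_injective_of_isUnit hJ (hmul.trans (Matrix.mulVec_zero _).symm)
  rw [hsum]
  exact Finset.sum_eq_zero fun q _ => by
    rw [show v (e q) = 0 from congrFun htail q, zero_smul]

/-- Inverse function theorem at a fixed point `0` for a `C²` self-map of `ℝ^m`. -/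
theorem exists_contDiffAt_local_inverse {m : ℕ} {f : (Fin m → ℝ) → (Fin m → ℝ)}
    (hf : ContDiff ℝ 2 f) (h0 : f 0 = 0) (hinj : Function.Injective (fderiv ℝ f 0)) :
    ∃ g : (Fin m → ℝ) → (Fin m → ℝ), g 0 = 0 ∧ ContDiffAt ℝ 2 g 0 ∧
      (∀ᶠ x in 𝓝 0, f (g x) = x) ∧ ∃ U ∈ 𝓝 (0 : Fin m → ℝ), Set.InjOn f U := by
  set e : (Fin m → ℝ) ≃L[ℝ] (Fin m → ℝ) :=
    (LinearEquiv.ofInjectiveEndo (fderiv ℝ f 0 : (Fin m → ℝ) →ₗ[ℝ] (Fin m → ℝ))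
      hinj).toContinuousLinearEquiv with he
  have hfe : HasFDerivAt f (e : (Fin m → ℝ) →L[ℝ] (Fin m → ℝ)) 0 := by
    have h1 := (hf.differentiable (by norm_num) 0).hasFDerivAt
    have h2 : (e : (Fin m → ℝ) →L[ℝ] (Fin m → ℝ)) = fderiv ℝ f 0 :=
      ContinuousLinearMap.ext fun _ => rfl
    rwa [h2]
  have hc : ContDiffAt ℝ 2 f 0 := hf.contDiffAt
  have hn : (2 : WithTop ℕ∞) ≠ 0 := by norm_num
  have hs := hc.hasStrictFDerivAt' hfe hn
  refine ⟨hs.localInverse f e 0, ?_, ?_, ?_, ?_⟩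
  · simpa [h0] using hs.localInverse_apply_image
  · have := hc.to_localInverse hfe hn
    rwa [h0] at this
  · have := hs.eventually_right_inverse
    rwa [h0] at this
  · exact ⟨(hs.toOpenPartialHomeomorph f).source,
      (hs.toOpenPartialHomeomorph f).open_source.mem_nhds hs.mem_toOpenPartialHomeomorph_source,
      (hs.toOpenPartialHomeomorph f).injOn⟩


/-- Gaussian-elimination / implicit-function construction of the maps `M i`
from a `C²` map `𝔅 : ℝ^m → ℝ^k` with `𝔅 0 = 0` whose Jacobian at `0` has its
trailing `i × i` minors invertible for `1 ≤ i ≤ min (m-1) k`. -/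
theorem stmt1 (k m : ℕ) (hk : 1 ≤ k) (hm : 1 ≤ m)
    (B : (Fin m → ℝ) → (Fin k → ℝ))
    (hB : ContDiff ℝ 2 B) (hB0 : B 0 = 0)
    (hJac : ∀ i : ℕ, ∀ h1 : 1 ≤ i, ∀ h2 : i ≤ min (m - 1) k,
      IsUnit (Matrix.of (fun p q : Fin i =>
        fderiv ℝ B 0 (Pi.single ⟨m - i + q.1, by have hq := q.isLt; omega⟩ 1)
          ⟨k - i + p.1, by have hp := p.isLt; omega⟩))) :
    ∃ ε > 0, ∃ M : (i : ℕ) → (Fin (m - i) → ℝ) → ℝ,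
      (∀ i : ℕ, 1 ≤ i → i ≤ min (m - 1) k →
        ContDiffOn ℝ 2 (M i) (Metric.ball 0 ε) ∧ M i 0 = 0) ∧
      (∀ y : Fin m → ℝ, ‖y‖ < ε →
        ∀ i : ℕ, ∀ h1 : 1 ≤ i, ∀ h2 : i ≤ min (m - 1) k,
          (∀ i' : ℕ, ∀ h1' : 1 ≤ i', ∀ h2' : i' ≤ i,
            y ⟨m - i', by omega⟩ =
              M i' (fun j : Fin (m - i') => y ⟨j.1, by have hj := j.isLt; omega⟩)) →
          (∀ i' : ℕ, ∀ h1' : 1 ≤ i', ∀ h2' : i' ≤ i,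
            B y ⟨k - i', by omega⟩ = 0)) := by
  set N := min (m - 1) k with hN
  have hloc : ∀ i : ℕ, ∃ g : (Fin m → ℝ) → (Fin m → ℝ), i ≤ N → g 0 = 0 ∧ ContDiffAt ℝ 2 g 0 ∧
      (∀ᶠ x in 𝓝 0, replaceTail B i (g x) = x) ∧
        ∃ U ∈ 𝓝 (0 : Fin m → ℝ), Set.InjOn (replaceTail B i) U := by
    intro i
    by_cases hi : i ≤ N
    · have hJ : IsUnit (Matrix.of (fun p q : Fin i =>
          fderiv ℝ B 0 (Pi.single ⟨m - i + q.1, by have hq := q.isLt; omega⟩ 1)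
            ⟨k - i + p.1, by have hp := p.isLt; omega⟩)) := by
        rcases Nat.eq_zero_or_pos i with rfl | hpos
        · exact isUnit_of_subsingleton _
        · exact hJac i hpos hi
      obtain ⟨g, hg⟩ := exists_contDiffAt_local_inverse (contDiff_replaceTail hB i)
        (replaceTail_zero hB0 i)
        (injective_fderiv_replaceTail hB i (by omega) (by omega) hJ)
      exact ⟨g, fun _ => hg⟩
    · exact ⟨id, fun h => absurd h hi⟩
  choose g hg using hloc
  have hU : ∃ U ∈ 𝓝 (0 : Fin m → ℝ), ∀ i ≤ N, Set.InjOn (replaceTail B i) U := by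
    choose! U hUn hUi using fun i hi => (hg i hi).2.2.2
    refine ⟨⋂ i ∈ Set.Iic N, U i, (biInter_mem (Set.finite_Iic N)).2 hUn, fun i hi => ?_⟩
    exact (hUi i hi).mono (Set.biInter_subset_of_mem (Set.mem_Iic.2 hi))
  obtain ⟨U, hUn, hUi⟩ := hU
  have hev : ∀ᶠ x in 𝓝 (0 : Fin m → ℝ), x ∈ U ∧ ∀ i ∈ Set.Iic N,
      ContDiffAt ℝ 2 (g i) x ∧ replaceTail B i (g i x) = x ∧ g i x ∈ U := by
    refine (eventually_mem_set.2 hUn).and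
      ((eventually_all_finite (Set.finite_Iic N)).2 fun i hi => ?_)
    obtain ⟨h0, hc, hr, -⟩ := hg i hi
    refine (hc.eventually (by decide)).and (hr.and ?_)
    exact hc.continuousAt.eventually_mem (by rwa [h0])
  obtain ⟨ε, hε, hball⟩ := Metric.eventually_nhds_iff_ball.1 hev
  refine ⟨ε, hε, fun i z => if h : m - i < m then g i (extendZero m i z) ⟨m - i, h⟩ else 0, ?_, ?_⟩
  · intro i h1 h2
    have hlt : m - i < m := by omega
    simp only [dif_pos hlt]
    refine ⟨fun z hz => ContDiffAt.contDiffWithinAt ?_, by simp [extendZero_zero, (hg i h2).1]⟩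
    have hz' : extendZero m i z ∈ Metric.ball 0 ε := by
      rw [mem_ball_zero_iff] at hz ⊢
      exact (norm_extendZero_le m i z).trans_lt hz
    have hc := ((hball _ hz').2 i h2).1
    exact contDiffAt_pi.1 (hc.comp z (contDiff_extendZero m i).contDiffAt) ⟨m - i, hlt⟩
  · intro y hy i
    have hyU : y ∈ U := (hball y (mem_ball_zero_iff.2 hy)).1
    induction i with
    | zero => intro h1; omega
    | succ i ih =>
      intro h1 h2 hM
      have hprev : ∀ i' : ℕ, ∀ h1' : 1 ≤ i', ∀ h2' : i' ≤ i, B y ⟨k - i', by omega⟩ = 0 := by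
        rcases Nat.eq_zero_or_pos i with rfl | hpos
        · intro i' h1' h2'
          omega
        · exact ih hpos (by omega) fun i' h1' h2' => hM i' h1' (by omega)
      set x := extendZero m (i + 1) (fun j : Fin (m - (i + 1)) =>
        y ⟨j.1, by have hj := j.isLt; omega⟩) with hx
      have hxb : x ∈ Metric.ball 0 ε := by
        rw [mem_ball_zero_iff]
        refine (norm_extendZero_le _ _ _).trans_lt (lt_of_le_of_lt ?_ hy)
        rw [pi_norm_le_iff_of_nonneg (norm_nonneg _)]
        exact fun j => norm_le_pi_norm y _
      obtain ⟨-, hw, hwU⟩ := (hball x hxb).2 (i + 1) h2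
      set w := g (i + 1) x with hwdef
      have hMi := hM (i + 1) h1 le_rfl
      beta_reduce at hMi
      rw [dif_pos (by omega), ← hx, ← hwdef] at hMi
      have htail : ∀ (w : Fin m → ℝ) (j : ℕ) (a : Fin m) (_ : m - j ≤ a.1 ∧ m ≤ k + a.1),
          replaceTail B j w a = B w ⟨k + a.1 - m, by have := a.isLt; omega⟩ :=
        fun w j a ha => dif_pos ha
      have hhead : ∀ (w : Fin m → ℝ) (j : ℕ) (a : Fin m), a.1 < m - j →
          replaceTail B j w a = w a :=
        fun w j a ha => dif_neg (by omega)
      have hwy : w = y := by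
        refine hUi i (by omega) hwU hyU ?_
        funext a
        have hwa := congrFun hw a
        rcases lt_trichotomy a.1 (m - (i + 1)) with ha | ha | ha
        · rw [hhead _ _ _ (by omega), hhead _ _ _ (by omega)]
          rw [hhead _ _ _ ha] at hwa
          simp only [hwa, hx, extendZero, dif_pos ha]
        · rw [hhead _ _ _ (by omega), hhead _ _ _ (by omega)]
          rw [show a = ⟨m - (i + 1), by omega⟩ from Fin.ext ha, hMi]
        · rw [htail _ _ _ (by omega), htail _ _ _ (by omega)]
          rw [htail _ _ _ (by omega)] at hwa
          rw [hwa, hx, extendZero, dif_neg (by omega),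
            ← hprev (m - a.1) (by have := a.isLt; omega) (by omega)]
          congr 2
          have := a.isLt
          omega
      intro i' h1' h2'
      have hya := congrFun hw ⟨m - i', by omega⟩
      rw [hwy, htail _ _ _ (by simp only; omega), hx, extendZero,
        dif_neg (by simp only; omega)] at hya
      rw [← hya]
      congr 2
      simp only
      omega
end

section
/- Let n ≥ 1 be an integer and L, K, D ≥ 0 be real numbers. Let λ : ℝ × ℝⁿ → ℝ satisfy |λ(x, y) − λ(x′, y′)| ≤ L(|x − x′| + ‖y − y′‖) for all x, x′ ∈ ℝ and y, y′ ∈ ℝⁿ. Let Ξ, Ξ̂ : ℝ × ℝ → ℝⁿ be such that ‖Ξ(t, x) − Ξ(t, x′)‖ ≤ K|x − x′| for all t, x, x′ and ‖Ξ̂(t, x) − Ξ(t, x)‖ ≤ D for all (t, x). Let s ≤ T be reals, ξ ∈ ℝ, and let x, x̂ : [s, T] → ℝ be differentiable functions with x(s) = x̂(s) = ξ, x′(t) = λ(x(t), Ξ(t, x(t))) and x̂′(t) = λ(x̂(t), Ξ̂(t, x̂(t))) for all t ∈ [s, T]. Then for all t ∈ [s, T], |x̂(t) − x(t)| ≤ D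 (e^{L(1+K)(t−s)} − 1)/(1+K). -/
/-- Gronwall-type comparison estimate between the characteristic flows of a
quasilinear hyperbolic system associated with two coefficient states `Ξ` and `Ξ̂`. -/
theorem stmt2 (n : ℕ) (hn : 1 ≤ n) (L K D : ℝ) (hL : 0 ≤ L) (hK : 0 ≤ K) (hD : 0 ≤ D)
    (lam : ℝ → EuclideanSpace ℝ (Fin n) → ℝ)
    (hlam : ∀ x x' : ℝ, ∀ y y' : EuclideanSpace ℝ (Fin n),
      |lam x y - lam x' y'| ≤ L * (|x - x'| + ‖y - y'‖))
    (Xi Xih : ℝ → ℝ → EuclideanSpace ℝ (Fin n))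
    (hXi : ∀ t x x' : ℝ, ‖Xi t x - Xi t x'‖ ≤ K * |x - x'|)
    (hXih : ∀ t x : ℝ, ‖Xih t x - Xi t x‖ ≤ D)
    (s T : ℝ) (hsT : s ≤ T) (ξ : ℝ) (x xh : ℝ → ℝ)
    (hxs : x s = ξ) (hxhs : xh s = ξ)
    (hx : ∀ t ∈ Set.Icc s T,
      HasDerivWithinAt x (lam (x t) (Xi t (x t))) (Set.Icc s T) t)
    (hxh : ∀ t ∈ Set.Icc s T,
      HasDerivWithinAt xh (lam (xh t) (Xih t (xh t))) (Set.Icc s T) t) :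
    ∀ t ∈ Set.Icc s T,
      |xh t - x t| ≤ D * (Real.exp (L * (1 + K) * (t - s)) - 1) / (1 + K) := by
  have hcont : ContinuousOn (fun t => xh t - x t) (Set.Icc s T) := fun t ht =>
    ((hxh t ht).sub (hx t ht)).continuousWithinAt
  have hderiv : ∀ t ∈ Set.Ico s T, HasDerivWithinAt (fun t => xh t - x t)
      (lam (xh t) (Xih t (xh t)) - lam (x t) (Xi t (x t))) (Set.Ici t) t := fun t ht =>
    ((hxh t (Set.Ico_subset_Icc_self ht)).sub
      (hx t (Set.Ico_subset_Icc_self ht))).mono_of_mem_nhdsWithin (Icc_mem_nhdsGE_of_mem ht)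
  have hbound : ∀ t ∈ Set.Ico s T, ‖lam (xh t) (Xih t (xh t)) - lam (x t) (Xi t (x t))‖ ≤
      L * (1 + K) * ‖xh t - x t‖ + L * D := by
    intro t _
    simp only [Real.norm_eq_abs]
    have hstate : ‖Xih t (xh t) - Xi t (x t)‖ ≤ D + K * |xh t - x t| :=
      (norm_sub_le_norm_sub_add_norm_sub _ (Xi t (xh t)) _).trans
        (add_le_add (hXih _ _) (hXi _ _ _))
    calc |lam (xh t) (Xih t (xh t)) - lam (x t) (Xi t (x t))|
        ≤ L * (|xh t - x t| + ‖Xih t (xh t) - Xi t (x t)‖) := hlam _ _ _ _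
      _ ≤ L * (|xh t - x t| + (D + K * |xh t - x t|)) := by gcongr
      _ = L * (1 + K) * |xh t - x t| + L * D := by ring
  intro t ht
  have hgronwall := norm_le_gronwallBound_of_norm_deriv_right_le (δ := 0) hcont hderiv
    (by simp [hxs, hxhs]) hbound t ht
  rw [Real.norm_eq_abs] at hgronwall
  refine hgronwall.trans_eq ?_
  have hK1 : 1 + K ≠ 0 := by positivity
  rcases eq_or_ne L 0 with rfl | hL0
  · simp [gronwallBound]
  · rw [gronwallBound_of_K_ne_0 (mul_ne_zero hL0 hK1)]
    field_simp
    ring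
end

section
/- Let n ≥ 1 be an integer, L, K ≥ 0, D ≥ 0 and λ₀ > 0 be real numbers. Let λ : ℝ × ℝⁿ → ℝ satisfy |λ(x, y) − λ(x′, y′)| ≤ L(|x − x′| + ‖y − y′‖) for all x, x′ ∈ ℝ, y, y′ ∈ ℝⁿ, and λ(x, y) ≥ λ₀ for all (x, y). Let Ξ, Ξ̂ : ℝ × ℝ → ℝⁿ be such that ‖Ξ(t, x) − Ξ(t, x′)‖ ≤ K|x − x′| for all t, x, x′ and ‖Ξ̂(t, x) − Ξ(t, x)‖ ≤ D for all (t, x). Let t₀ ∈ ℝ and τ, τ̂ > 0, and let x : [t₀, t₀+τ] → ℝ and x̂ : [t₀, t₀+τ̂] → ℝ be differentiable with x(t₀) = x̂(t₀) = 1, x′(t) = −λ(x(t), Ξ(t, x(t))) on [t₀, t₀+τ], x̂′(t) = −λ(x̂(t), Ξ̂(t, x̂(t))) on [t₀, t₀+τ̂], and x(t₀+τ) = 0 = x̂(t₀+τ̂). Then, setting τ_m = min{τ, τ̂}, one has |τ̂ − τ| ≤ (L D τ_m / λ₀) e^{L(1+K)τ_m}. -/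
theorem gronwallBound_zero_le {C ε s : ℝ} (hC : 0 ≤ C) (hε : 0 ≤ ε) :
    gronwallBound 0 C ε s ≤ ε * s * Real.exp (C * s) := by
  rcases hC.eq_or_lt with rfl | hC
  · simp [gronwallBound_K0]
  · rw [gronwallBound_of_K_ne_0 hC.ne']
    have h1 : Real.exp (C * s) - 1 ≤ C * s * Real.exp (C * s) := by
      have h2 := mul_le_mul_of_nonneg_right (Real.add_one_le_exp (-(C * s)))
        (Real.exp_pos (C * s)).le
      rw [← Real.exp_add, neg_add_cancel, Real.exp_zero] at h2
      linarith
    calc 0 * Real.exp (C * s) + ε / C * (Real.exp (C * s) - 1)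
        ≤ 0 * Real.exp (C * s) + ε / C * (C * s * Real.exp (C * s)) := by gcongr
      _ = ε * s * Real.exp (C * s) := by field_simp; ring

/-- If the derivative of `f` is at most `-c` on `[a, b]`, then `f` decreases at rate at least `c`
on every terminal subinterval. -/
theorem mul_sub_le_of_hasDerivWithinAt_le_neg {f f' : ℝ → ℝ} {a b c s : ℝ}
    (hf : ∀ t ∈ Set.Icc a b, HasDerivWithinAt f (f' t) (Set.Icc a b) t)
    (hf' : ∀ t ∈ Set.Icc a b, f' t ≤ -c) (has : a ≤ s) (hsb : s ≤ b) :
    c * (b - s) ≤ f s - f b := by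
  rcases hsb.eq_or_lt with rfl | hsb
  · simp
  · have hsub : Set.Icc s b ⊆ Set.Icc a b := Set.Icc_subset_Icc_left has
    obtain ⟨ξ, hξ, h⟩ := exists_hasDerivAt_eq_slope f f' hsb
      (fun t ht => (hf t (hsub ht)).continuousWithinAt.mono hsub)
      (fun t ht => (hf t (hsub (Set.Ioo_subset_Icc_self ht))).hasDerivAt
        (Icc_mem_nhds (has.trans_lt ht.1) ht.2))
    have h1 := hf' ξ (hsub (Set.Ioo_subset_Icc_self hξ))
    rw [h, div_le_iff₀ (sub_pos.2 hsb)] at h1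
    linarith

/-- Comparison of exit times at `0` of two scalar trajectories, the first one being
the first to exit. -/
theorem exit_time_sub_le {v w : ℝ → ℝ → ℝ} {C ε c t0 τ σ : ℝ} {x y : ℝ → ℝ}
    (hC : 0 ≤ C) (hε : 0 ≤ ε) (hc : 0 < c)
    (hvw : ∀ t p q, |v t p - w t q| ≤ C * |p - q| + ε) (hw : ∀ t q, c ≤ w t q)
    (hτ : 0 ≤ τ) (hτσ : τ ≤ σ) (h0 : x t0 = y t0)
    (hx : ∀ t ∈ Set.Icc t0 (t0 + τ),
      HasDerivWithinAt x (-v t (x t)) (Set.Icc t0 (t0 + τ)) t)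
    (hy : ∀ t ∈ Set.Icc t0 (t0 + σ),
      HasDerivWithinAt y (-w t (y t)) (Set.Icc t0 (t0 + σ)) t)
    (hxend : x (t0 + τ) = 0) (hyend : y (t0 + σ) = 0) :
    σ - τ ≤ ε * τ / c * Real.exp (C * τ) := by
  have hsub : Set.Icc t0 (t0 + τ) ⊆ Set.Icc t0 (t0 + σ) := Set.Icc_subset_Icc_right (by linarith)
  have hd : ∀ t ∈ Set.Icc t0 (t0 + τ),
      HasDerivWithinAt (fun t => x t - y t) (-v t (x t) - -w t (y t)) (Set.Icc t0 (t0 + τ)) t :=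
    fun t ht => (hx t ht).sub ((hy t (hsub ht)).mono hsub)
  have hg := norm_le_gronwallBound_of_norm_deriv_right_le (δ := 0) (K := C) (ε := ε)
    (fun t ht => (hd t ht).continuousWithinAt)
    (fun t ht => (hd t (Set.Ico_subset_Icc_self ht)).mono_of_mem_nhdsWithin
      (Icc_mem_nhdsGE_of_mem ht))
    (by simp [h0])
    (fun t _ => by
      rw [neg_sub_neg, norm_sub_rev]
      exact hvw t (x t) (y t))
    (t0 + τ) (Set.right_mem_Icc.2 (by linarith))
  have hg' := hg.trans (gronwallBound_zero_le hC hε)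
  rw [hxend, zero_sub, norm_neg, add_sub_cancel_left] at hg'
  have hlow := mul_sub_le_of_hasDerivWithinAt_le_neg (s := t0 + τ) (c := c) hy
    (fun t _ => neg_le_neg (hw t (y t))) (by linarith) (by linarith)
  rw [hyend] at hlow
  rw [div_mul_eq_mul_div, le_div_iff₀ hc]
  linarith [Real.le_norm_self (y (t0 + τ))]

/-- Comparison of exit times of backward characteristic curves starting at `x = 1`
for two coefficient states `Ξ` and `Ξ̂`, in terms of the uniform distance `D`
between them. -/
theorem stmt3 (n : ℕ) (hn : 1 ≤ n) (L K D lam0 : ℝ)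
    (hL : 0 ≤ L) (hK : 0 ≤ K) (hD : 0 ≤ D) (hlam0 : 0 < lam0)
    (lam : ℝ → EuclideanSpace ℝ (Fin n) → ℝ)
    (hlam : ∀ x x' : ℝ, ∀ y y' : EuclideanSpace ℝ (Fin n),
      |lam x y - lam x' y'| ≤ L * (|x - x'| + ‖y - y'‖))
    (hlow : ∀ x : ℝ, ∀ y : EuclideanSpace ℝ (Fin n), lam0 ≤ lam x y)
    (Xi Xih : ℝ → ℝ → EuclideanSpace ℝ (Fin n))
    (hXi : ∀ t x x' : ℝ, ‖Xi t x - Xi t x'‖ ≤ K * |x - x'|)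
    (hXih : ∀ t x : ℝ, ‖Xih t x - Xi t x‖ ≤ D)
    (t0 τ τh : ℝ) (hτ : 0 < τ) (hτh : 0 < τh) (x xh : ℝ → ℝ)
    (hx1 : x t0 = 1) (hxh1 : xh t0 = 1)
    (hx : ∀ t ∈ Set.Icc t0 (t0 + τ),
      HasDerivWithinAt x (-lam (x t) (Xi t (x t))) (Set.Icc t0 (t0 + τ)) t)
    (hxh : ∀ t ∈ Set.Icc t0 (t0 + τh),
      HasDerivWithinAt xh (-lam (xh t) (Xih t (xh t))) (Set.Icc t0 (t0 + τh)) t)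
    (hxend : x (t0 + τ) = 0) (hxhend : xh (t0 + τh) = 0) :
    |τh - τ| ≤ L * D * min τ τh / lam0 * Real.exp (L * (1 + K) * min τ τh) := by
  have hvw : ∀ t p q : ℝ,
      |lam p (Xi t p) - lam q (Xih t q)| ≤ L * (1 + K) * |p - q| + L * D := by
    intro t p q
    have h1 : ‖Xi t p - Xih t q‖ ≤ K * |p - q| + D :=
      (norm_sub_le_norm_sub_add_norm_sub _ (Xi t q) _).trans
        (add_le_add (hXi t p q) (by rw [norm_sub_rev]; exact hXih t q))
    calc |lam p (Xi t p) - lam q (Xih t q)|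
        ≤ L * (|p - q| + ‖Xi t p - Xih t q‖) := hlam _ _ _ _
      _ ≤ L * (|p - q| + (K * |p - q| + D)) := by gcongr
      _ = L * (1 + K) * |p - q| + L * D := by ring
  have hC : 0 ≤ L * (1 + K) := by positivity
  have hε : 0 ≤ L * D := by positivity
  rcases le_total τ τh with h | h
  · rw [min_eq_left h, abs_of_nonneg (sub_nonneg.2 h)]
    exact exit_time_sub_le (v := fun t p => lam p (Xi t p)) (w := fun t p => lam p (Xih t p))
      hC hε hlam0 hvw (fun _ _ => hlow _ _) hτ.le h (hx1.trans hxh1.symm) hx hxh hxend hxhend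
  · rw [min_eq_right h, abs_sub_comm, abs_of_nonneg (sub_nonneg.2 h)]
    exact exit_time_sub_le (v := fun t p => lam p (Xih t p)) (w := fun t p => lam p (Xi t p))
      hC hε hlam0 (fun t p q => by rw [abs_sub_comm, abs_sub_comm p]; exact hvw t q p)
      (fun _ _ => hlow _ _) hτh.le h (hxh1.trans hx1.symm) hxh hx hxhend hxend
end

section
/- Let α, β ∈ ℝ satisfy α² + β² − 4αβ > 0, let (a, b) ∈ ℝ² with (a, b) ≠ (0, 0), and let Y > 0 satisfy P_{a,b}(Y) = 0. Then Y · (3(α−β)²Y² − 4b²Y − 2ab(α+β)) = 2b²Y² + 4ab(α+β)Y + 3a²(α²+β²), this quantity is strictly positive, and in particular the derivative P′_{a,b}(Y) = 3(α−β)²Y² − 4b²Y − 2ab(α+β) is strictly positive. -/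
/-- The cubic polynomial `P_{a,b}(Y) = (α−β)²Y³ − (2b²Y² + 2ab(α+β)Y + a²(α²+β²))`. -/
def P (α β a b Y : ℝ) : ℝ :=
  (α - β) ^ 2 * Y ^ 3 - (2 * b ^ 2 * Y ^ 2 + 2 * a * b * (α + β) * Y + a ^ 2 * (α ^ 2 + β ^ 2))

/-- At any positive root `Y` of `P_{a,b}` with `(a,b) ≠ (0,0)` and `α² + β² − 4αβ > 0`,
one has `Y P′_{a,b}(Y) = 2b²Y² + 4ab(α+β)Y + 3a²(α²+β²) > 0`, and in particular
`P′_{a,b}(Y) > 0`. -/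
theorem stmt5 (α β : ℝ) (h : α ^ 2 + β ^ 2 - 4 * (α * β) > 0)
    (a b : ℝ) (hab : (a, b) ≠ ((0 : ℝ), (0 : ℝ)))
    (Y : ℝ) (hY : 0 < Y) (hroot : P α β a b Y = 0) :
    Y * (3 * (α - β) ^ 2 * Y ^ 2 - 4 * b ^ 2 * Y - 2 * a * b * (α + β)) =
      2 * b ^ 2 * Y ^ 2 + 4 * a * b * (α + β) * Y + 3 * a ^ 2 * (α ^ 2 + β ^ 2) ∧
    0 < 2 * b ^ 2 * Y ^ 2 + 4 * a * b * (α + β) * Y + 3 * a ^ 2 * (α ^ 2 + β ^ 2) ∧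
    0 < 3 * (α - β) ^ 2 * Y ^ 2 - 4 * b ^ 2 * Y - 2 * a * b * (α + β) := by
  have heq : Y * (3 * (α - β) ^ 2 * Y ^ 2 - 4 * b ^ 2 * Y - 2 * a * b * (α + β)) =
      2 * b ^ 2 * Y ^ 2 + 4 * a * b * (α + β) * Y + 3 * a ^ 2 * (α ^ 2 + β ^ 2) := by
    unfold P at hroot
    linear_combination 3 * hroot
  have hpos : 0 < 2 * b ^ 2 * Y ^ 2 + 4 * a * b * (α + β) * Y + 3 * a ^ 2 * (α ^ 2 + β ^ 2) := by
    have hsq : 2 * b ^ 2 * Y ^ 2 + 4 * a * b * (α + β) * Y + 3 * a ^ 2 * (α ^ 2 + β ^ 2) =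
        2 * (b * Y + a * (α + β)) ^ 2 + a ^ 2 * (α ^ 2 + β ^ 2 - 4 * (α * β)) := by ring
    rw [hsq]
    by_cases ha : a = 0
    · have hb : b ≠ 0 := fun hb => hab (by rw [ha, hb])
      subst ha
      simp only [zero_mul, add_zero, ne_eq, OfNat.ofNat_ne_zero, not_false_eq_true, zero_pow]
      positivity
    · exact add_pos_of_nonneg_of_pos (by positivity) (mul_pos (by positivity) h)
  exact ⟨heq, hpos, pos_of_mul_pos_right (heq ▸ hpos) hY.le⟩
end

section
/- Let α, β ∈ ℝ satisfy α² + β² − 4αβ > 0 (which forces α ≠ β), and let (a, b) ∈ ℝ² with (a, b) ≠ (0, 0). Then there exists exactly one real number Y > 0 such that P_{a,b}(Y) = 0. -/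
/-- Two positive roots of `P α β a b` coincide: the quadratic form left after factoring out
`y - x` from the difference of the two equations is positive definite. -/
theorem P_pos_root_unique {α β a b x y : ℝ} (h : α ^ 2 + β ^ 2 - 4 * (α * β) > 0)
    (hab : (a, b) ≠ ((0 : ℝ), (0 : ℝ))) (hx : 0 < x) (hy : 0 < y)
    (hPx : P α β a b x = 0) (hPy : P α β a b y = 0) : x = y := by
  unfold P at hPx hPy
  have hfac : (y - x) * (2 * (b * (x * y)) ^ 2 + 2 * (α + β) * (b * (x * y)) * (a * (x + y))
      + a ^ 2 * (α ^ 2 + β ^ 2) * ((x + y) ^ 2 - x * y)) = 0 := by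
    linear_combination x ^ 3 * hPy - y ^ 3 * hPx
  have hpos : 0 < 2 * (b * (x * y)) ^ 2 + 2 * (α + β) * (b * (x * y)) * (a * (x + y))
      + a ^ 2 * (α ^ 2 + β ^ 2) * ((x + y) ^ 2 - x * y) := by
    rcases eq_or_ne a 0 with rfl | ha
    · have hb : b ≠ 0 := by
        rintro rfl
        exact hab rfl
      have : 0 < 2 * (b * (x * y)) ^ 2 := by positivity
      linarith
    · have h1 : 0 ≤ (2 * (b * (x * y)) + (α + β) * (a * (x + y))) ^ 2 := sq_nonneg _
      have h2 : 0 ≤ a ^ 2 * (α ^ 2 + β ^ 2) * (x - y) ^ 2 := by positivity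
      have h3 : 0 < (a * (x + y)) ^ 2 * (α ^ 2 + β ^ 2 - 4 * (α * β)) := by positivity
      linarith
  have := (mul_eq_zero.mp hfac).resolve_right hpos.ne'
  linarith

theorem P_exists_pos_root {α β a b : ℝ} (h : α ^ 2 + β ^ 2 - 4 * (α * β) > 0)
    (hab : (a, b) ≠ ((0 : ℝ), (0 : ℝ))) : ∃ Y : ℝ, 0 < Y ∧ P α β a b Y = 0 := by
  have hD : 0 < (α - β) ^ 2 := by nlinarith [sq_nonneg (α + β)]
  have hT : 0 < α ^ 2 + β ^ 2 := by nlinarith [sq_nonneg (α + β)]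
  rcases eq_or_ne a 0 with rfl | ha
  · have hb : b ≠ 0 := by
      rintro rfl
      exact hab rfl
    refine ⟨2 * b ^ 2 / (α - β) ^ 2, by positivity, ?_⟩
    unfold P
    have hne : α - β ≠ 0 := fun h0 => by simp [h0] at hD
    field_simp
    ring
  · have hP0 : P α β a b 0 < 0 := by
      have : 0 < a ^ 2 * (α ^ 2 + β ^ 2) := by positivity
      unfold P
      linarith
    obtain ⟨M, hM1, hM⟩ : ∃ M : ℝ, 1 ≤ M ∧ 0 ≤ P α β a b M := by
      set C := 2 * b ^ 2 + |2 * a * b * (α + β)| + a ^ 2 * (α ^ 2 + β ^ 2) with hC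
      have hC0 : 0 ≤ C := by positivity
      have hM1 : 1 ≤ 1 + C / (α - β) ^ 2 := le_add_of_nonneg_right (by positivity)
      have hDM : (α - β) ^ 2 * (1 + C / (α - β) ^ 2) = (α - β) ^ 2 + C := by
        rw [mul_add, mul_one, mul_div_cancel₀ _ hD.ne']
      refine ⟨1 + C / (α - β) ^ 2, hM1, ?_⟩
      generalize 1 + C / (α - β) ^ 2 = M at hM1 hDM
      have hlin : 2 * a * b * (α + β) * M ≤ |2 * a * b * (α + β)| * M ^ 2 :=
        mul_le_mul (le_abs_self _) (by nlinarith) (by linarith) (abs_nonneg _)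
      have hconst : a ^ 2 * (α ^ 2 + β ^ 2) * 1 ≤ a ^ 2 * (α ^ 2 + β ^ 2) * M ^ 2 :=
        mul_le_mul_of_nonneg_left (one_le_pow₀ hM1) (by positivity)
      have hcube : (α - β) ^ 2 * M ^ 3 = ((α - β) ^ 2 + C) * M ^ 2 := by
        rw [← hDM]
        ring
      have hlead : 0 ≤ (α - β) ^ 2 * M ^ 2 := by positivity
      unfold P
      rw [hcube, hC]
      linarith
    have hcont : Continuous (P α β a b) := by
      unfold P
      fun_prop
    obtain ⟨Y, hY, hPY⟩ := intermediate_value_Icc (zero_le_one.trans hM1) hcont.continuousOn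
      ⟨hP0.le, hM⟩
    refine ⟨Y, hY.1.lt_of_ne ?_, hPY⟩
    rintro rfl
    exact hP0.ne hPY

/-- If `α² + β² − 4αβ > 0` and `(a, b) ≠ (0, 0)`, then `P_{a,b}` has exactly one
positive real root. -/
theorem stmt6 (α β : ℝ) (h : α ^ 2 + β ^ 2 - 4 * (α * β) > 0)
    (a b : ℝ) (hab : (a, b) ≠ ((0 : ℝ), (0 : ℝ))) :
    ∃! Y : ℝ, 0 < Y ∧ P α β a b Y = 0 := by
  obtain ⟨Y, hY, hPY⟩ := P_exists_pos_root h hab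
  exact ⟨Y, ⟨hY, hPY⟩, fun Z hZ => P_pos_root_unique h hab hZ.1 hY hZ.2 hPY⟩
end

section
/- Let α, β ∈ ℝ with α ≠ β. For every ε > 0 there exists δ > 0 such that for all a, b, Y ∈ ℝ with |a| ≤ δ, |b| ≤ δ, Y ≥ 0 and P_{a,b}(Y) = 0, one has Y ≤ ε. -/
/-- All nonnegative roots of `P_{a,b}` tend to `0` uniformly as `(a, b) → (0, 0)`. -/
theorem stmt7 (α β : ℝ) (hne : α ≠ β) :
    ∀ ε > (0 : ℝ), ∃ δ > (0 : ℝ), ∀ a b Y : ℝ,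
      |a| ≤ δ → |b| ≤ δ → 0 ≤ Y → P α β a b Y = 0 → Y ≤ ε := by
  intro ε hε
  have hc : 0 < (α - β) ^ 2 := by
    have := sub_ne_zero.mpr hne
    positivity
  obtain ⟨η, hη, hη₁, hη₂⟩ : ∃ η > 0, 8 * η ≤ (α - β) ^ 2 * ε ∧
      4 * (α ^ 2 + β ^ 2) * η ≤ (α - β) ^ 2 * ε ^ 3 := by
    refine ⟨min ((α - β) ^ 2 * ε / 8) ((α - β) ^ 2 * ε ^ 3 / (4 * (α ^ 2 + β ^ 2 + 1))),
      lt_min (by positivity) (by positivity), ?_, ?_⟩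
    · linarith [min_le_left ((α - β) ^ 2 * ε / 8)
        ((α - β) ^ 2 * ε ^ 3 / (4 * (α ^ 2 + β ^ 2 + 1)))]
    · have hpos : 0 < min ((α - β) ^ 2 * ε / 8)
          ((α - β) ^ 2 * ε ^ 3 / (4 * (α ^ 2 + β ^ 2 + 1))) :=
        lt_min (by positivity) (by positivity)
      have h := (le_div_iff₀ (by positivity)).mp (min_le_right ((α - β) ^ 2 * ε / 8)
        ((α - β) ^ 2 * ε ^ 3 / (4 * (α ^ 2 + β ^ 2 + 1))))
      linarith
  refine ⟨√η, Real.sqrt_pos.mpr hη, fun a b Y ha hb _ hP => ?_⟩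
  have ha2 : a ^ 2 ≤ η := by
    simpa [Real.sq_sqrt hη.le] using pow_le_pow_left₀ (abs_nonneg a) ha 2
  have hb2 : b ^ 2 ≤ η := by
    simpa [Real.sq_sqrt hη.le] using pow_le_pow_left₀ (abs_nonneg b) hb 2
  by_contra! hY
  have hquad : (α - β) ^ 2 * Y ^ 3 ≤ 4 * b ^ 2 * Y ^ 2 + 2 * a ^ 2 * (α ^ 2 + β ^ 2) := by
    unfold P at hP
    linarith [sq_nonneg (b * Y - a * α), sq_nonneg (b * Y - a * β)]
  have hbY : b ^ 2 * Y ^ 2 ≤ η * Y ^ 2 := by gcongr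
  have haS : a ^ 2 * (α ^ 2 + β ^ 2) ≤ η * (α ^ 2 + β ^ 2) := by gcongr
  have hηY : 8 * η * Y ^ 2 ≤ (α - β) ^ 2 * ε * Y ^ 2 := by gcongr
  have hY2 : 0 < Y ^ 2 := pow_pos (hε.trans hY) 2
  have hεY : (α - β) ^ 2 * ε * Y ^ 2 < (α - β) ^ 2 * Y * Y ^ 2 := by gcongr
  have hε3 : (α - β) ^ 2 * ε ^ 3 < (α - β) ^ 2 * Y ^ 3 := by gcongr
  linarith
end

section
/- Let α, β ∈ ℝ satisfy α² + β² − 4αβ > 0 (which forces α ≠ β). Then there exist a neighborhood O of (0, 0) in ℝ² and a continuous function Ȳ : O → [0, ∞) with Ȳ(0, 0) = 0 such that for every (a, b) ∈ O with (a, b) ≠ (0, 0), one has Ȳ(a, b) > 0 and P_{a,b}(Ȳ(a, b)) = 0. -/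
/-- For `y > 0`, the sign of `P α β a b y` is that of `P α β a b y / y ^ 3`, which is strictly
increasing in `y`. -/
lemma P_mul_cube_lt {α β a b y z : ℝ} (h : α ^ 2 + β ^ 2 - 4 * (α * β) > 0)
    (hab : a ≠ 0 ∨ b ≠ 0) (hy : 0 < y) (hyz : y < z) :
    P α β a b y * z ^ 3 < P α β a b z * y ^ 3 := by
  have hz : 0 < z := hy.trans hyz
  have disc : 0 < 2 * (α ^ 2 + β ^ 2) * (z ^ 2 + z * y + y ^ 2) - (α + β) ^ 2 * (z + y) ^ 2 := by
    have h₁ : 0 < (α ^ 2 + β ^ 2 - 4 * (α * β)) * (z ^ 2 + z * y + y ^ 2) := by positivity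
    nlinarith [mul_nonneg (sq_nonneg (α + β)) (sq_nonneg (z - y))]
  have quad : 0 < (2 * (b * y * z) + a * (α + β) * (z + y)) ^ 2 + a ^ 2 *
      (2 * (α ^ 2 + β ^ 2) * (z ^ 2 + z * y + y ^ 2) - (α + β) ^ 2 * (z + y) ^ 2) := by
    by_cases ha : a = 0
    · have hb : b ≠ 0 := hab.resolve_left (not_not.mpr ha)
      subst ha
      have : 0 < (2 * (b * y * z)) ^ 2 := by positivity
      simpa using this
    · positivity
  have := mul_pos (sub_pos.mpr hyz) quad
  unfold P
  linarith

lemma continuous_P (α β : ℝ) {X : Type*} [TopologicalSpace X] {a b Y : X → ℝ}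
    (ha : Continuous a) (hb : Continuous b) (hY : Continuous Y) :
    Continuous fun x => P α β (a x) (b x) (Y x) := by
  unfold P
  fun_prop

lemma exists_pos_root_P {α β a b : ℝ} (hne : α ≠ β) (hab : a ≠ 0 ∨ b ≠ 0) :
    ∃ Y, 0 < Y ∧ P α β a b Y = 0 := by
  have hc : 0 < (α - β) ^ 2 := by
    have := sub_ne_zero.mpr hne
    positivity
  by_cases ha : a = 0
  · have hb : b ≠ 0 := hab.resolve_left (not_not.mpr ha)
    refine ⟨2 * b ^ 2 / (α - β) ^ 2, by positivity, ?_⟩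
    have := sub_ne_zero.mpr hne
    subst ha
    unfold P
    field_simp
    ring
  · have hT : 0 < α ^ 2 + β ^ 2 := by nlinarith [sq_nonneg (α + β)]
    have h0 : P α β a b 0 < 0 := by
      have : 0 < a ^ 2 * (α ^ 2 + β ^ 2) := by positivity
      unfold P
      linarith
    obtain ⟨K, hK⟩ : ∃ K, K = 2 * b ^ 2 + |2 * a * b * (α + β)| + a ^ 2 * (α ^ 2 + β ^ 2) :=
      ⟨_, rfl⟩
    have hK0 : 0 ≤ K := by rw [hK]; positivity
    obtain ⟨M, hM⟩ : ∃ M, M = 1 + K / (α - β) ^ 2 := ⟨_, rfl⟩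
    have hM1 : 1 ≤ M := by
      have : 0 ≤ K / (α - β) ^ 2 := by positivity
      linarith
    have hcM : (α - β) ^ 2 * M = (α - β) ^ 2 + K := by
      rw [hM]; field_simp
    have hPM : 0 ≤ P α β a b M := by
      have e : (α - β) ^ 2 * M ^ 3 = ((α - β) ^ 2 + K) * M ^ 2 := by rw [← hcM]; ring
      have hMM : M ≤ M ^ 2 := by nlinarith
      have h₁ : 2 * a * b * (α + β) * M ≤ |2 * a * b * (α + β)| * M ^ 2 :=
        mul_le_mul (le_abs_self _) hMM (by linarith) (abs_nonneg _)
      have h₂ : a ^ 2 * (α ^ 2 + β ^ 2) * 1 ≤ a ^ 2 * (α ^ 2 + β ^ 2) * M ^ 2 := by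
        gcongr
        linarith
      have h₃ : 0 < (α - β) ^ 2 * M ^ 2 := by positivity
      unfold P
      rw [e, hK]
      linarith
    obtain ⟨Y, hY, hPY⟩ := intermediate_value_Icc (by linarith : (0 : ℝ) ≤ M)
      (continuous_P α β (continuous_const (y := a)) (continuous_const (y := b))
        continuous_id).continuousOn ⟨h0.le, hPM⟩
    refine ⟨Y, lt_of_le_of_ne hY.1 ?_, hPY⟩
    rintro rfl
    exact h0.ne hPY

/-- `P_{a,b}` changes sign exactly once on the positive half-line; at the origin this degenerates
to `P_{0,0}` being positive there. -/
lemma exists_sign_change_P {α β : ℝ} (h : α ^ 2 + β ^ 2 - 4 * (α * β) > 0) (p : ℝ × ℝ) :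
    ∃ Y, 0 ≤ Y ∧ (p = (0, 0) → Y = 0) ∧ (p ≠ (0, 0) → 0 < Y ∧ P α β p.1 p.2 Y = 0) ∧
      (∀ y, 0 < y → y < Y → P α β p.1 p.2 y < 0) ∧ ∀ y, Y < y → 0 < P α β p.1 p.2 y := by
  have hne : α ≠ β := by
    rintro rfl
    nlinarith [sq_nonneg α]
  by_cases hp : p = (0, 0)
  · refine ⟨0, le_rfl, fun _ => rfl, fun hp' => absurd hp hp', fun y h₁ h₂ => by linarith, ?_⟩
    intro y hy
    have := sub_ne_zero.mpr hne
    have : 0 < (α - β) ^ 2 * y ^ 3 := by positivity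
    simpa [hp, P] using this
  · have hab : p.1 ≠ 0 ∨ p.2 ≠ 0 := by
      by_contra! hc
      exact hp (Prod.ext hc.1 hc.2)
    obtain ⟨Y, hY, hPY⟩ := exists_pos_root_P hne hab
    refine ⟨Y, hY.le, fun hp' => absurd hp' hp, fun _ => ⟨hY, hPY⟩, fun y hy hyY => ?_,
      fun y hy => ?_⟩
    · have := P_mul_cube_lt h hab hy hyY
      rw [hPY, zero_mul] at this
      exact neg_of_mul_neg_left this (by positivity)
    · have := P_mul_cube_lt h hab hY hy
      rw [hPY, zero_mul] at this
      exact pos_of_mul_pos_left this (by positivity)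

/-- Near the origin, the unique positive root of `P_{a,b}` (with value `0` at
`(a,b) = (0,0)`) depends continuously on `(a, b)`. -/
theorem stmt8 (α β : ℝ) (h : α ^ 2 + β ^ 2 - 4 * (α * β) > 0) :
    ∃ O : Set (ℝ × ℝ), O ∈ nhds ((0 : ℝ), (0 : ℝ)) ∧
      ∃ Ybar : ℝ × ℝ → ℝ, ContinuousOn Ybar O ∧
        (∀ p ∈ O, 0 ≤ Ybar p) ∧ Ybar (0, 0) = 0 ∧
        ∀ p ∈ O, p ≠ ((0 : ℝ), (0 : ℝ)) →
          0 < Ybar p ∧ P α β p.1 p.2 (Ybar p) = 0 := by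
  choose Y hY0 hYz hYr hYlt hYgt using exists_sign_change_P h
  have hcont (y : ℝ) : Continuous fun p : ℝ × ℝ => P α β p.1 p.2 y :=
    continuous_P α β continuous_fst continuous_snd continuous_const
  refine ⟨Set.univ, Filter.univ_mem, Y, ?_, fun p _ => hY0 p, hYz _ rfl, fun p _ => hYr p⟩
  rw [continuousOn_univ, continuous_iff_continuousAt]
  refine fun p => tendsto_order.mpr ⟨fun y hy => ?_, fun y hy => ?_⟩
  · rcases lt_or_ge y 0 with hy0 | hy0
    · exact Filter.Eventually.of_forall fun q => hy0.trans_le (hY0 q)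
    · obtain ⟨w, hyw, hwY⟩ := exists_between hy
      have hw : 0 < w := hy0.trans_lt hyw
      filter_upwards [(hcont w).continuousAt.eventually_lt_const (hYlt p w hw hwY)] with q hq
      exact hyw.trans_le (not_lt.mp fun hlt => (hYgt q w hlt).not_gt hq)
  · have hy0 : 0 < y := (hY0 p).trans_lt hy
    filter_upwards [(hcont y).continuousAt.eventually_const_lt (hYgt p y hy)] with q hq
    refine lt_of_not_ge fun hle => ?_
    rcases hle.lt_or_eq with hlt | heq
    · exact (hYlt q y hy0 hlt).not_gt hq
    · have hq0 : q ≠ (0, 0) := fun hq0 => hy0.ne' (heq.trans (hYz q hq0))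
      exact hq.ne' (heq ▸ (hYr q hq0).2)
end

section
/- Let α, β ∈ ℝ satisfy α² + β² − 4αβ > 0 (which forces α ≠ β). Then there exist a neighborhood O of (0, 0) in ℝ² and continuous functions φ₀, ψ₀ : O → ℝ with φ₀(0, 0) = ψ₀(0, 0) = 0 such that for every (a, b) ∈ O: φ₀(a, b) + ψ₀(a, b) = a and −α φ₀(a, b) − β ψ₀(a, b) = b · (φ₀(a, b)² + ψ₀(a, b)²)^{1/3}. -/
/-- The cubic whose nonnegative root is `Y = (φ₀² + ψ₀²)^{1/3}`. -/
def initialCubic (α β : ℝ) (p : ℝ × ℝ) (y : ℝ) : ℝ :=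
  (β - α) ^ 2 * y ^ 3 - ((β * p.1 + p.2 * y) ^ 2 + (α * p.1 + p.2 * y) ^ 2)

lemma continuous_initialCubic_left (α β y : ℝ) : Continuous fun p => initialCubic α β p y := by
  unfold initialCubic; fun_prop

lemma continuous_initialCubic_right (α β : ℝ) (p : ℝ × ℝ) : Continuous (initialCubic α β p) := by
  unfold initialCubic; fun_prop

lemma sub_sq_pos_of_quadratic_pos {α β : ℝ} (h : α ^ 2 + β ^ 2 - 4 * (α * β) > 0) :
    0 < (β - α) ^ 2 := by
  nlinarith [sq_nonneg (α + β)]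

/-- The discriminant condition makes the comparison factor of the cubic positive. -/
lemma comparison_factor_pos {α β a b y z : ℝ} (h : α ^ 2 + β ^ 2 - 4 * (α * β) > 0)
    (hy : 0 < y) (hz : 0 < z) (hab : a ≠ 0 ∨ b ≠ 0) :
    0 < 2 * b ^ 2 * (y * z) ^ 2 + 2 * (α + β) * a * b * (y * z) * (y + z)
      + (α ^ 2 + β ^ 2) * a ^ 2 * (y ^ 2 + y * z + z ^ 2) := by
  have key : 2 * b ^ 2 * (y * z) ^ 2 + 2 * (α + β) * a * b * (y * z) * (y + z)
      + (α ^ 2 + β ^ 2) * a ^ 2 * (y ^ 2 + y * z + z ^ 2)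
      = (2 * (b * (y * z)) + (α + β) * (a * (y + z))) ^ 2 / 2
        + (α ^ 2 + β ^ 2 - 4 * (α * β)) / 4 * (a * (y + z)) ^ 2
        + (α ^ 2 + β ^ 2) * a ^ 2 * (y - z) ^ 2 / 4 := by ring
  by_cases ha : a = 0
  · subst ha
    have hb : b ≠ 0 := by simpa using hab
    have : 0 < 2 * b ^ 2 * (y * z) ^ 2 := by positivity
    linarith
  · rw [key]
    have : 0 < (α ^ 2 + β ^ 2 - 4 * (α * β)) / 4 * (a * (y + z)) ^ 2 := by positivity
    positivity

/-- At positive arguments, the sign of the cubic tells on which side of a positive root one is. -/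
lemma initialCubic_mul_cube {α β : ℝ} {p : ℝ × ℝ} {y z : ℝ}
    (h : α ^ 2 + β ^ 2 - 4 * (α * β) > 0) (hy : 0 < y) (hz : 0 < z)
    (hroot : initialCubic α β p z = 0) :
    ∃ K > 0, initialCubic α β p y * z ^ 3 = (y - z) * K := by
  have hκ := sub_sq_pos_of_quadratic_pos h
  have hab : p.1 ≠ 0 ∨ p.2 ≠ 0 := by
    by_contra! hp
    have : 0 < (β - α) ^ 2 * z ^ 3 := by positivity
    simp only [initialCubic, hp.1, hp.2] at hroot
    linarith
  refine ⟨_, comparison_factor_pos h hy hz hab, ?_⟩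
  unfold initialCubic at *
  linear_combination y ^ 3 * hroot

lemma exists_initialCubic_root {α β : ℝ} (h : α ^ 2 + β ^ 2 - 4 * (α * β) > 0) (p : ℝ × ℝ) :
    ∃ z, 0 ≤ z ∧ initialCubic α β p z = 0 ∧
      ∀ y, 0 < y → z < y → 0 < initialCubic α β p y := by
  have hκ := sub_sq_pos_of_quadratic_pos h
  have hδ : β - α ≠ 0 := sq_pos_iff.1 hκ
  have finish {z : ℝ} (hz : 0 < z) (hroot : initialCubic α β p z = 0) :
      ∃ z, 0 ≤ z ∧ initialCubic α β p z = 0 ∧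
        ∀ y, 0 < y → z < y → 0 < initialCubic α β p y := by
    refine ⟨z, hz.le, hroot, fun y hy hzy => ?_⟩
    obtain ⟨K, hK, e⟩ := initialCubic_mul_cube h hy hz hroot
    exact pos_of_mul_pos_left (e ▸ mul_pos (sub_pos.2 hzy) hK) (by positivity)
  obtain ⟨a, b⟩ := p
  by_cases ha : a = 0
  · subst ha
    by_cases hb : b = 0
    · subst hb
      refine ⟨0, le_rfl, by simp [initialCubic], fun y hy _ => ?_⟩
      have : 0 < (β - α) ^ 2 * y ^ 3 := by positivity
      simpa [initialCubic] using this
    · refine finish (z := 2 * b ^ 2 / (β - α) ^ 2) (by positivity) ?_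
      simp only [initialCubic]
      field_simp
      ring
  · set q := (β * a) ^ 2 + (α * a) ^ 2
    have hs : 0 < α ^ 2 + β ^ 2 := by
      nlinarith [sq_nonneg (α + β)]
    have hneg : initialCubic α β (a, b) 0 < 0 := by
      have : 0 < (α ^ 2 + β ^ 2) * a ^ 2 := by positivity
      simp only [initialCubic]
      linarith
    set M := 1 + (2 * q + 4 * b ^ 2) / (β - α) ^ 2 with hM
    have hM1 : 1 ≤ M := by
      have : 0 ≤ (2 * q + 4 * b ^ 2) / (β - α) ^ 2 := by positivity
      linarith
    have hMκ : 2 * q + 4 * b ^ 2 ≤ (β - α) ^ 2 * M := by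
      have : (β - α) ^ 2 * M = (β - α) ^ 2 + (2 * q + 4 * b ^ 2) := by
        rw [hM]
        field_simp
      linarith
    have hpos : 0 ≤ initialCubic α β (a, b) M := by
      have h1 := mul_le_mul_of_nonneg_right hMκ (sq_nonneg M)
      have h2 : 0 ≤ q * (M ^ 2 - 1) :=
        mul_nonneg (by positivity) (by nlinarith)
      simp only [initialCubic]
      nlinarith [sq_nonneg (β * a - b * M), sq_nonneg (α * a - b * M)]
    obtain ⟨z, hz, hroot⟩ := intermediate_value_Icc (by linarith : (0 : ℝ) ≤ M)
      (continuous_initialCubic_right α β (a, b)).continuousOn ⟨hneg.le, hpos⟩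
    refine finish (hz.1.lt_of_ne ?_) hroot
    rintro rfl
    exact hneg.ne hroot

/-- The nonnegative root of the cubic can be chosen continuously in the parameters. -/
lemma exists_continuous_initialCubic_root {α β : ℝ} (h : α ^ 2 + β ^ 2 - 4 * (α * β) > 0) :
    ∃ Y : ℝ × ℝ → ℝ, Continuous Y ∧ (∀ p, 0 ≤ Y p) ∧ ∀ p, initialCubic α β p (Y p) = 0 := by
  choose Y hY0 hroot hYpos using exists_initialCubic_root h
  refine ⟨Y, continuous_iff_continuousAt.2 fun p => tendsto_order.2 ⟨fun l hl => ?_,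
    fun u hu => ?_⟩, hY0, hroot⟩
  · rcases lt_or_ge l 0 with hl0 | hl0
    · exact Filter.Eventually.of_forall fun q => hl0.trans_le (hY0 q)
    obtain ⟨y, hly, hyY⟩ := exists_between hl
    have hy : 0 < y := hl0.trans_lt hly
    have hneg : initialCubic α β p y < 0 := by
      have hz := hy.trans hyY
      obtain ⟨K, hK, e⟩ := initialCubic_mul_cube h hy hz (hroot p)
      exact neg_of_mul_neg_left (e ▸ mul_neg_of_neg_of_pos (sub_neg.2 hyY) hK) (by positivity)
    filter_upwards [(continuous_initialCubic_left α β y).continuousAt.eventually_lt_const hneg]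
      with q hq
    refine hly.trans_le (le_of_not_gt fun hlt => ?_)
    exact (hYpos q y hy hlt).not_gt hq
  · have hu0 : 0 < u := (hY0 p).trans_lt hu
    filter_upwards [(continuous_initialCubic_left α β u).continuousAt.eventually_const_lt
      (hYpos p u hu0 hu)] with q hq
    by_contra! hle
    obtain ⟨K, hK, e⟩ := initialCubic_mul_cube h hu0 (hu0.trans_le hle) (hroot q)
    have h1 := mul_pos hq (pow_pos (hu0.trans_le hle) 3)
    have h2 := mul_nonpos_of_nonpos_of_nonneg (sub_nonpos.2 hle) hK.le
    linarith


/-- Continuous selection, near the origin, of initial data `(φ₀, ψ₀)` satisfying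
`φ₀ + ψ₀ = a` and `−αφ₀ − βψ₀ = b (φ₀² + ψ₀²)^{1/3}`, vanishing at `(a,b) = (0,0)`. -/
theorem stmt9 (α β : ℝ) (h : α ^ 2 + β ^ 2 - 4 * (α * β) > 0) :
    ∃ O : Set (ℝ × ℝ), O ∈ nhds ((0 : ℝ), (0 : ℝ)) ∧
      ∃ φ₀ ψ₀ : ℝ × ℝ → ℝ, ContinuousOn φ₀ O ∧ ContinuousOn ψ₀ O ∧
        φ₀ (0, 0) = 0 ∧ ψ₀ (0, 0) = 0 ∧
        ∀ p ∈ O,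
          φ₀ p + ψ₀ p = p.1 ∧
          -α * φ₀ p - β * ψ₀ p =
            p.2 * ((φ₀ p) ^ 2 + (ψ₀ p) ^ 2) ^ ((1 : ℝ) / 3) := by
  have hκ := sub_sq_pos_of_quadratic_pos h
  have hδ : β - α ≠ 0 := sq_pos_iff.1 hκ
  obtain ⟨Y, hYc, hY0, hroot⟩ := exists_continuous_initialCubic_root h
  refine ⟨Set.univ, Filter.univ_mem, fun p => (β * p.1 + p.2 * Y p) / (β - α),
    fun p => -(α * p.1 + p.2 * Y p) / (β - α), by fun_prop, by fun_prop, by simp, by simp,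
    fun p _ => ⟨by field_simp; ring, ?_⟩⟩
  have hcube : ((β * p.1 + p.2 * Y p) / (β - α)) ^ 2 + (-(α * p.1 + p.2 * Y p) / (β - α)) ^ 2
      = Y p ^ 3 := by
    have := hroot p
    unfold initialCubic at this
    field_simp
    linarith
  have hY : (Y p ^ 3) ^ ((1 : ℝ) / 3) = Y p := by
    simpa using Real.pow_rpow_inv_natCast (hY0 p) (n := 3) (by norm_num)
  rw [hcube, hY]
  field_simp
  ring
end

section
/- Let α, β > 0 and set μ = min{α, β}. Let φ, ψ : [0, ∞) → ℝ be continuous functions such that at every t ≥ 0 with (φ(t), ψ(t)) ≠ (0, 0), both φ and ψ are differentiable at t with φ′(t) = −α φ(t)/(φ(t)² + ψ(t)²)^{1/3} and ψ′(t) = −β ψ(t)/(φ(t)² + ψ(t)²)^{1/3}. Then φ(t) = ψ(t) = 0 for every t ≥ (3/(2μ)) · (φ(0)² + ψ(0)²)^{1/3}. -/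
/-- A nonnegative continuous function on `[0, ∞)` whose derivative is at most `-c < 0` wherever the
function is positive vanishes from time `g 0 / c` on. -/
theorem eq_zero_of_hasDerivAt_le_neg {g : ℝ → ℝ} {c : ℝ} (hc : 0 < c)
    (hg : ContinuousOn g (Set.Ici 0)) (hg0 : ∀ t, 0 ≤ g t)
    (hd : ∀ t, 0 < t → 0 < g t → ∃ d ≤ -c, HasDerivAt g d t)
    {T : ℝ} (hT0 : 0 ≤ T) (hT : g 0 ≤ c * T) : g T = 0 := by
  by_contra hne
  have hpos : 0 < g T := lt_of_le_of_ne (hg0 T) (Ne.symm hne)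
  have hgT : ContinuousOn g (Set.Icc 0 T) := hg.mono Set.Icc_subset_Ici_self
  have hclosed : IsClosed (Set.Icc 0 T ∩ g ⁻¹' {0}) :=
    hgT.preimage_isClosed_of_isClosed isClosed_Icc isClosed_singleton
  have hcomp : IsCompact (insert 0 (Set.Icc 0 T ∩ g ⁻¹' {0})) :=
    (isCompact_Icc.of_isClosed_subset hclosed Set.inter_subset_left).insert 0
  obtain ⟨s, hs, hmax⟩ := hcomp.exists_isGreatest (Set.insert_nonempty _ _)
  have hs0 : 0 ≤ s := hmax (Set.mem_insert _ _)
  have hsT : s ≤ T := by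
    rcases hs with rfl | hs
    · exact hT0
    · exact hs.1.2
  have hgs : g s ≤ c * (T - s) := by
    rcases hs with rfl | hs
    · simpa using hT
    · have : g s = 0 := hs.2
      rw [this]
      exact mul_nonneg hc.le (sub_nonneg.2 hsT)
  have hlt : s < T := by
    refine lt_of_le_of_ne hsT fun h => ?_
    subst h
    simp only [sub_self, mul_zero] at hgs
    exact hpos.not_ge hgs
  have hder : ∀ t ∈ Set.Ioo s T, ∃ d ≤ -c, HasDerivAt g d t := fun t ht => by
    refine hd t (hs0.trans_lt ht.1) (lt_of_le_of_ne (hg0 t) fun h => ?_)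
    exact ht.1.not_ge (hmax (Or.inr ⟨⟨hs0.trans ht.1.le, ht.2.le⟩, h.symm⟩))
  have hdiff : ∀ t ∈ Set.Ioo s T, HasDerivAt g (deriv g t) t := fun t ht => by
    obtain ⟨d, -, h⟩ := hder t ht
    exact h.differentiableAt.hasDerivAt
  obtain ⟨t, ht, hslope⟩ := exists_hasDerivAt_eq_slope g (deriv g) hlt
    (hgT.mono (Set.Icc_subset_Icc_left hs0)) hdiff
  obtain ⟨d, hdc, h⟩ := hder t ht
  rw [h.deriv, eq_div_iff (sub_pos.2 hlt).ne'] at hslope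
  nlinarith [mul_le_mul_of_nonneg_right hdc (sub_pos.2 hlt).le]

/-- Finite-time extinction for the planar system `φ′ = −αφ/(φ² + ψ²)^{1/3}`,
`ψ′ = −βψ/(φ² + ψ²)^{1/3}` with `α, β > 0`: every solution vanishes for
`t ≥ (3/(2 min{α,β})) (φ(0)² + ψ(0)²)^{1/3}`. -/
theorem stmt12 (α β : ℝ) (hα : 0 < α) (hβ : 0 < β) (φ ψ : ℝ → ℝ)
    (hφc : ContinuousOn φ (Set.Ici 0)) (hψc : ContinuousOn ψ (Set.Ici 0))
    (hdyn : ∀ t : ℝ, 0 ≤ t → (φ t, ψ t) ≠ ((0 : ℝ), (0 : ℝ)) →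
      HasDerivWithinAt φ
        (-α * φ t / ((φ t) ^ 2 + (ψ t) ^ 2) ^ ((1 : ℝ) / 3)) (Set.Ici 0) t ∧
      HasDerivWithinAt ψ
        (-β * ψ t / ((φ t) ^ 2 + (ψ t) ^ 2) ^ ((1 : ℝ) / 3)) (Set.Ici 0) t) :
    ∀ t : ℝ,
      3 / (2 * min α β) * ((φ 0) ^ 2 + (ψ 0) ^ 2) ^ ((1 : ℝ) / 3) ≤ t →
      φ t = 0 ∧ ψ t = 0 := by
  have hμ : 0 < min α β := lt_min hα hβ
  intro T hT
  have hT0 : 0 ≤ T := le_trans (by positivity) hT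
  have key : ((φ T) ^ 2 + (ψ T) ^ 2) ^ ((1 : ℝ) / 3) = 0 := by
    refine eq_zero_of_hasDerivAt_le_neg (g := fun t => ((φ t) ^ 2 + (ψ t) ^ 2) ^ ((1 : ℝ) / 3))
      (c := 2 * min α β / 3) (by positivity) ?_ (fun t => by positivity) ?_ hT0 ?_
    · exact ((hφc.pow 2).add (hψc.pow 2)).rpow_const fun _ _ => Or.inr (by norm_num)
    · intro t ht hpos
      have hV0 : 0 ≤ φ t ^ 2 + ψ t ^ 2 := by positivity
      have hVne : φ t ^ 2 + ψ t ^ 2 ≠ 0 := fun h => by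
        simp only [h] at hpos
        norm_num at hpos
      have hV : 0 < φ t ^ 2 + ψ t ^ 2 := lt_of_le_of_ne hV0 hVne.symm
      obtain ⟨h1, h2⟩ := hdyn t ht.le fun h => by
        simp only [Prod.mk.injEq] at h
        simp [h.1, h.2] at hVne
      have hn : Set.Ici (0 : ℝ) ∈ nhds t := Ici_mem_nhds ht
      have h3 := (((h1.hasDerivAt hn).pow 2).add ((h2.hasDerivAt hn).pow 2)).rpow_const
        (p := (1 : ℝ) / 3) (Or.inl hVne)
      refine ⟨_, ?_, h3⟩
      have hW : (φ t ^ 2 + ψ t ^ 2) ^ ((1 : ℝ) / 3 - 1) * (φ t ^ 2 + ψ t ^ 2)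
          = (φ t ^ 2 + ψ t ^ 2) ^ ((1 : ℝ) / 3) := by
        rw [Real.rpow_sub_one hVne, div_mul_cancel₀ _ hVne]
      have hle : min α β * (φ t ^ 2 + ψ t ^ 2) ≤ α * φ t ^ 2 + β * ψ t ^ 2 := by
        nlinarith [mul_le_mul_of_nonneg_right (min_le_left α β) (sq_nonneg (φ t)),
          mul_le_mul_of_nonneg_right (min_le_right α β) (sq_nonneg (ψ t))]
      have hE : 0 < (φ t ^ 2 + ψ t ^ 2) ^ ((1 : ℝ) / 3 - 1) := Real.rpow_pos_of_pos hV _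
      have hmul := mul_le_mul_of_nonneg_left hle hE.le
      simp only [Pi.add_apply, Pi.pow_apply]
      have hpos' : 0 < (φ t ^ 2 + ψ t ^ 2) ^ ((1 : ℝ) / 3) := hpos
      generalize (φ t ^ 2 + ψ t ^ 2) ^ ((1 : ℝ) / 3 - 1) = E at *
      generalize (φ t ^ 2 + ψ t ^ 2) ^ ((1 : ℝ) / 3) = W at *
      have hmul' : min α β * W ≤ E * (α * φ t ^ 2 + β * ψ t ^ 2) := by
        rw [← hW]; linarith
      have heq : min α β ≤ E * (α * φ t ^ 2 + β * ψ t ^ 2) / W := (le_div_iff₀ hpos').2 hmul'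
      calc _ = -(2 / 3) * (E * (α * φ t ^ 2 + β * ψ t ^ 2) / W) := by
            push_cast
            ring
        _ ≤ _ := by linarith
    · rw [div_mul_eq_mul_div, div_le_iff₀ (by positivity)] at hT
      linarith
  rw [Real.rpow_eq_zero (by positivity) (by norm_num)] at key
  constructor <;> nlinarith [sq_nonneg (φ T), sq_nonneg (ψ T)]
end

section
/- For all real numbers α, β, T > 0 there exist L > 0 and ε₀ > 0 such that for every ε ∈ [0, ε₀] and every pair of continuous functions Y, Z : [0, T] → [0, ∞) satisfying Y(t) ≤ ∫₀ᵗ (α Y(s) + β Z(s)) ds + ε Z(T) for all t ∈ [0, T], one has sup_{t ∈ [0, T]} e^{−Lt} Y(t) ≤ (1/2) · sup_{t ∈ [0, T]} e^{−Lt} Z(t). -/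
/-- A continuous function on `[0, T]` is bounded by its exponentially weighted supremum. -/
theorem le_sSup_weighted_mul_exp {L T : ℝ} {f : ℝ → ℝ} (hf : ContinuousOn f (Set.Icc 0 T))
    {t : ℝ} (ht : t ∈ Set.Icc 0 T) :
    f t ≤ sSup ((fun t => Real.exp (-L * t) * f t) '' Set.Icc (0 : ℝ) T) * Real.exp (L * t) := by
  have hcont : ContinuousOn (fun t => Real.exp (-L * t) * f t) (Set.Icc 0 T) := by fun_prop
  have hle := le_csSup (isCompact_Icc.image_of_continuousOn hcont).bddAbove
    (Set.mem_image_of_mem _ ht)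
  have hexp : Real.exp (-L * t) * Real.exp (L * t) = 1 := by
    rw [← Real.exp_add, neg_mul, neg_add_cancel, Real.exp_zero]
  calc f t = Real.exp (-L * t) * f t * Real.exp (L * t) := by linear_combination -f t * hexp
    _ ≤ _ := mul_le_mul_of_nonneg_right hle (Real.exp_pos _).le

/-- A function dominated by `M * exp (L * s)` has integral at most `M / L * exp (L * t)`. -/
theorem integral_le_div_mul_exp {L M t : ℝ} {u : ℝ → ℝ} (hL : 0 < L) (hM : 0 ≤ M) (ht : 0 ≤ t)
    (hu : ContinuousOn u (Set.Icc 0 t)) (hle : ∀ s ∈ Set.Icc 0 t, u s ≤ M * Real.exp (L * s)) :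
    ∫ s in (0 : ℝ)..t, u s ≤ M / L * Real.exp (L * t) := by
  have hmono : ∫ s in (0 : ℝ)..t, u s ≤ ∫ s in (0 : ℝ)..t, M * Real.exp (L * s) :=
    intervalIntegral.integral_mono_on ht (hu.intervalIntegrable_of_Icc ht)
      (Continuous.intervalIntegrable (by fun_prop) _ _) hle
  have heq : ∫ s in (0 : ℝ)..t, M * Real.exp (L * s) = M / L * (Real.exp (L * t) - 1) := by
    rw [intervalIntegral.integral_const_mul, intervalIntegral.integral_comp_mul_left _ hL.ne',
      integral_exp, mul_zero, Real.exp_zero, smul_eq_mul]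
    ring
  have hML : 0 ≤ M / L := div_nonneg hM hL.le
  linarith

open intervalIntegral in
/-- Weighted sup-norm Gronwall-type comparison lemma: for `α, β, T > 0` there
exist `L > 0` and `ε₀ > 0` such that any nonnegative continuous `Y, Z` on `[0, T]`
with `Y(t) ≤ ∫₀ᵗ (αY + βZ) + εZ(T)` for `0 ≤ ε ≤ ε₀` satisfy
`sup e^{−Lt}Y(t) ≤ (1/2) sup e^{−Lt}Z(t)`. -/
theorem stmt13 (α β T : ℝ) (hα : 0 < α) (hβ : 0 < β) (hT : 0 < T) :
    ∃ L > (0 : ℝ), ∃ ε₀ > (0 : ℝ), ∀ ε ∈ Set.Icc (0 : ℝ) ε₀,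
      ∀ Y Z : ℝ → ℝ,
        ContinuousOn Y (Set.Icc 0 T) → ContinuousOn Z (Set.Icc 0 T) →
        (∀ t ∈ Set.Icc (0 : ℝ) T, 0 ≤ Y t) →
        (∀ t ∈ Set.Icc (0 : ℝ) T, 0 ≤ Z t) →
        (∀ t ∈ Set.Icc (0 : ℝ) T,
          Y t ≤ (∫ s in (0 : ℝ)..t, (α * Y s + β * Z s)) + ε * Z T) →
        sSup ((fun t => Real.exp (-L * t) * Y t) '' Set.Icc (0 : ℝ) T) ≤
          (1 / 2) * sSup ((fun t => Real.exp (-L * t) * Z t) '' Set.Icc (0 : ℝ) T) := by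
  refine ⟨4 * α + 8 * β, by positivity, Real.exp (-((4 * α + 8 * β) * T)) / 4, by positivity, ?_⟩
  rintro ε ⟨hε, hε'⟩ Y Z hY hZ hY0 hZ0 hYZ
  set L := 4 * α + 8 * β with hLdef
  have hL : 0 < L := by positivity
  set y := sSup ((fun t => Real.exp (-L * t) * Y t) '' Set.Icc (0 : ℝ) T) with hy
  set z := sSup ((fun t => Real.exp (-L * t) * Z t) '' Set.Icc (0 : ℝ) T) with hz
  have hy0 : 0 ≤ y := Real.sSup_nonneg (by
    rintro _ ⟨t, ht, rfl⟩
    exact mul_nonneg (Real.exp_pos _).le (hY0 t ht))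
  have hz0 : 0 ≤ z := Real.sSup_nonneg (by
    rintro _ ⟨t, ht, rfl⟩
    exact mul_nonneg (Real.exp_pos _).le (hZ0 t ht))
  have hTmem : T ∈ Set.Icc (0 : ℝ) T := ⟨hT.le, le_rfl⟩
  have hεZ : ε * Z T ≤ z / 4 := by
    calc ε * Z T ≤ Real.exp (-(L * T)) / 4 * (z * Real.exp (L * T)) :=
          mul_le_mul hε' (le_sSup_weighted_mul_exp hZ hTmem) (hZ0 T hTmem) (by positivity)
      _ = z / 4 := by
          rw [Real.exp_neg]
          field_simp
  have hdiv : (α * y + β * z) / L ≤ y / 4 + z / 8 := by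
    rw [div_le_iff₀ hL, hLdef]
    nlinarith [mul_nonneg hα.le hz0, mul_nonneg hβ.le hy0]
  have hbound : y ≤ y / 4 + z / 8 + z / 4 := by
    refine csSup_le ((Set.nonempty_Icc.2 hT.le).image _) ?_
    rintro _ ⟨t, ht, rfl⟩
    have hsub : Set.Icc 0 t ⊆ Set.Icc 0 T := Set.Icc_subset_Icc_right ht.2
    have hY' := hY.mono hsub
    have hZ' := hZ.mono hsub
    have hint : ∫ s in (0 : ℝ)..t, (α * Y s + β * Z s) ≤
        (α * y + β * z) / L * Real.exp (L * t) := by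
      refine integral_le_div_mul_exp hL (by positivity) ht.1 (by fun_prop) fun s hs => ?_
      have hYs := mul_le_mul_of_nonneg_left
        (le_sSup_weighted_mul_exp (L := L) hY (hsub hs)) hα.le
      have hZs := mul_le_mul_of_nonneg_left
        (le_sSup_weighted_mul_exp (L := L) hZ (hsub hs)) hβ.le
      rw [← hy] at hYs
      rw [← hz] at hZs
      linarith
    have hexp : 1 ≤ Real.exp (L * t) := Real.one_le_exp (mul_nonneg hL.le ht.1)
    have hYt : Y t ≤ (y / 4 + z / 8 + z / 4) * Real.exp (L * t) := by
      have hmul := mul_le_mul_of_nonneg_right hdiv (Real.exp_pos (L * t)).le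
      have hz4 : z / 4 ≤ z / 4 * Real.exp (L * t) :=
        le_mul_of_one_le_right (by positivity) hexp
      linarith [hYZ t ht]
    change Real.exp (-L * t) * Y t ≤ _
    rw [neg_mul, Real.exp_neg, inv_mul_le_iff₀ (Real.exp_pos _), mul_comm]
    exact hYt
  linarith
end

section
/- Let α, β > 0 with α² + β² − 4αβ > 0 (which forces α ≠ β), and let δ > 0. Then there exists ε > 0 such that for all a, b ∈ ℝ with |a| + |b| < ε there exist continuous functions φ, ψ : [0, ∞) → ℝ with the following properties: at every t ≥ 0 with (φ(t), ψ(t)) ≠ (0, 0), φ and ψ are differentiable at t with φ′(t) = −α φ(t)/(φ(t)² + ψ(t)²)^{1/3} and ψ′(t) = −β ψ(t)/(φ(t)² + ψ(t)²)^{1/3}; the function ζ := φ + ψ is continuously differentiable on [0, ∞) with ζ(0) = a and ζ′(0) = b; and φ(t) = ψ(t) = 0 (hence ζ(t) = 0) for all t ≥ δ/2. -/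
open Filter Topology Set

/-- A positive speed `M`, bounded below on the negative half-line and with bounded primitive,
defines a time change `S` that blows up in finite time. -/
theorem exists_time_change {M : ℝ → ℝ} {m B : ℝ} (hM : Continuous M) (hpos : ∀ s, 0 < M s)
    (hm : 0 < m) (hlow : ∀ s ≤ 0, m ≤ M s) (hB : ∀ s, ∫ x in (0 : ℝ)..s, M x ≤ B) :
    ∃ (T : ℝ) (S : ℝ → ℝ), 0 < T ∧ T ≤ B ∧ S 0 = 0 ∧
      (∀ t < T, HasDerivAt S (M (S t))⁻¹ t) ∧ Tendsto S (𝓝[<] T) atTop := by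
  set F : ℝ → ℝ := fun s => ∫ x in (0 : ℝ)..s, M x with hF
  have hd : ∀ s, HasDerivAt F (M s) s := fun s => hM.integral_hasStrictDerivAt 0 s |>.hasDerivAt
  have hmono : StrictMono F := strictMono_of_hasDerivAt_pos hd hpos
  have hcont : Continuous F := continuous_iff_continuousAt.2 fun s => (hd s).continuousAt
  have hF0 : F 0 = 0 := by simp [hF]
  have hbdd : BddAbove (range F) := ⟨B, by rintro _ ⟨s, rfl⟩; exact hB s⟩
  have hneg : ∀ s ≤ 0, F s ≤ m * s := by
    intro s hs
    have : ∫ x in s..0, m ≤ ∫ x in s..0, M x :=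
      intervalIntegral.integral_mono_on hs (by simp) (hM.intervalIntegrable _ _)
        fun x hx => hlow x hx.2
    rw [intervalIntegral.integral_const, intervalIntegral.integral_symm 0 s, smul_eq_mul] at this
    simp only [hF]
    linarith
  have hlt : ∀ s, F s < ⨆ x, F x := fun s =>
    (hmono (lt_add_one s)).trans_le (le_ciSup hbdd (s + 1))
  have hsurj : ∀ t < ⨆ x, F x, ∃ s, F s = t := by
    intro t ht
    obtain ⟨u, hu⟩ := exists_lt_of_lt_ciSup ht
    refine mem_range_of_exists_le_of_exists_ge hcont ⟨min 0 (t / m), ?_⟩ ⟨u, hu.le⟩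
    refine (hneg _ (min_le_left _ _)).trans ?_
    calc m * min 0 (t / m) ≤ m * (t / m) := by gcongr; exact min_le_right _ _
      _ = t := by field_simp
  choose! S hS using hsurj
  have hSF : ∀ s, S (F s) = s := fun s => hmono.injective (hS _ (hlt s))
  have hSmono : StrictMonoOn S (Iio (⨆ x, F x)) := by
    intro x hx y hy hxy
    rwa [← hmono.lt_iff_lt, hS x hx, hS y hy]
  have himage : S '' Iio (⨆ x, F x) = univ :=
    eq_univ_of_forall fun s => ⟨F s, hlt s, hSF s⟩
  refine ⟨⨆ x, F x, S, hF0 ▸ hlt 0, ciSup_le hB, ?_, ?_, ?_⟩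
  · simpa [hF0] using hSF 0
  · intro t ht
    have hn : Iio (⨆ x, F x) ∈ 𝓝 t := Iio_mem_nhds ht
    refine HasDerivAt.of_local_left_inverse ?_ (hd (S t)) (hpos _).ne' ?_
    · exact hSmono.continuousAt_of_image_mem_nhds hn (by rw [himage]; exact univ_mem)
    · filter_upwards [hn] with y hy using hS y hy
  · refine tendsto_atTop.2 fun s => ?_
    filter_upwards [Ioo_mem_nhdsLT (hlt s)] with t ht
    rw [← hmono.le_iff_le, hS t ht.2]
    exact ht.1.le

theorem planar_norm_pos {x y : ℝ} (hxy : ¬(x = 0 ∧ y = 0)) : 0 < x ^ 2 + y ^ 2 := by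
  by_contra! hle
  exact hxy ⟨by nlinarith [sq_nonneg x, sq_nonneg y], by nlinarith [sq_nonneg x, sq_nonneg y]⟩

theorem continuous_planar_field (α β : ℝ) :
    Continuous fun z : ℝ × ℝ =>
      (α * z.1 + β * z.2) / (z.1 ^ 2 + z.2 ^ 2) ^ ((1 : ℝ) / 3) := by
  refine continuous_iff_continuousAt.2 fun z => ?_
  by_cases hz : z.1 = 0 ∧ z.2 = 0
  · obtain rfl : z = 0 := Prod.ext hz.1 hz.2
    have hlim : Tendsto (fun z : ℝ × ℝ => (|α| + |β|) * (z.1 ^ 2 + z.2 ^ 2) ^ ((1 : ℝ) / 6))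
        (𝓝 0) (𝓝 0) := by
      have : Continuous fun z : ℝ × ℝ => (|α| + |β|) * (z.1 ^ 2 + z.2 ^ 2) ^ ((1 : ℝ) / 6) :=
        continuous_const.mul (Continuous.rpow_const (by fun_prop) fun _ => Or.inr (by norm_num))
      have h0 := this.tendsto 0
      simpa using h0
    have hval : (α * (0 : ℝ × ℝ).1 + β * (0 : ℝ × ℝ).2) /
        ((0 : ℝ × ℝ).1 ^ 2 + (0 : ℝ × ℝ).2 ^ 2) ^ ((1 : ℝ) / 3) = 0 := by simp
    unfold ContinuousAt
    beta_reduce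
    rw [hval]
    refine squeeze_zero_norm (fun w => ?_) hlim
    by_cases hw : w.1 = 0 ∧ w.2 = 0
    · simp [hw.1, hw.2]
    have hN := planar_norm_pos hw
    rw [Real.norm_eq_abs, abs_div, abs_of_pos (Real.rpow_pos_of_pos hN _),
      div_le_iff₀ (Real.rpow_pos_of_pos hN _), mul_assoc, ← Real.rpow_add hN,
      show (1 : ℝ) / 6 + 1 / 3 = 1 / 2 by norm_num, ← Real.sqrt_eq_rpow]
    have h1 : |w.1| ≤ √(w.1 ^ 2 + w.2 ^ 2) :=
      Real.abs_le_sqrt (by nlinarith [sq_nonneg w.2])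
    have h2 : |w.2| ≤ √(w.1 ^ 2 + w.2 ^ 2) :=
      Real.abs_le_sqrt (by nlinarith [sq_nonneg w.1])
    calc |α * w.1 + β * w.2| ≤ |α| * |w.1| + |β| * |w.2| := by
          simpa [abs_mul] using abs_add_le (α * w.1) (β * w.2)
      _ ≤ |α| * √(w.1 ^ 2 + w.2 ^ 2) + |β| * √(w.1 ^ 2 + w.2 ^ 2) := by gcongr
      _ = _ := by ring
  · have hN := planar_norm_pos hz
    refine ContinuousAt.div (by fun_prop) ?_ (Real.rpow_pos_of_pos hN _).ne'
    exact ContinuousAt.rpow_const (by fun_prop) (Or.inl hN.ne')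

/-- Small prescribed values of `ζ` and `ζ′` are attained at small nonzero states. -/
theorem exists_planar_initial_state {α β η : ℝ} (hβ : 0 < β) (hne : α ≠ β) (hη : 0 < η) :
    ∃ ε > (0 : ℝ), ∀ a b : ℝ, |a| + |b| < ε → ¬(a = 0 ∧ b = 0) →
      ∃ p q : ℝ, ¬(p = 0 ∧ q = 0) ∧ p + q = a ∧
        -(α * p + β * q) = b * (p ^ 2 + q ^ 2) ^ ((1 : ℝ) / 3) ∧
        (p ^ 2 + q ^ 2) ^ ((1 : ℝ) / 3) ≤ η := by
  have hk : 0 < |α - β| := abs_pos.2 (sub_ne_zero.2 hne)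
  obtain ⟨R, hR, hR5⟩ : ∃ R > (0 : ℝ), 5 * R ^ 2 ≤ η ^ 3 :=
    ⟨√(η ^ 3 / 5), by positivity, by rw [Real.sq_sqrt (by positivity)]; linarith⟩
  have hcube : ∀ x : ℝ, 0 ≤ x → (x ^ 3) ^ ((1 : ℝ) / 3) = x := fun x hx => by
    rw [← Real.rpow_natCast, ← Real.rpow_mul hx]; norm_num
  have hcbrt : ∀ x : ℝ, 0 ≤ x → x ≤ 5 * R ^ 2 → x ^ ((1 : ℝ) / 3) ≤ η := fun x hx hxR =>
    (Real.rpow_le_rpow hx (hxR.trans hR5) (by norm_num)).trans_eq (hcube η hη.le)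
  refine ⟨min R (|α - β| * R / (β + η)), by positivity, fun a b hab hab0 => ?_⟩
  obtain ⟨haR, hab'⟩ := lt_min_iff.1 hab
  rw [lt_div_iff₀ (by positivity)] at hab'
  have ha := abs_nonneg a
  have hb := abs_nonneg b
  by_cases ha0 : a = 0
  · subst ha0
    have hb0 : b ≠ 0 := fun hb0 => hab0 ⟨rfl, hb0⟩
    have hk0 : α - β ≠ 0 := sub_ne_zero.2 hne
    obtain ⟨c, hc⟩ : ∃ c, c * (α - β) = -b := ⟨-b / (α - β), by field_simp⟩
    have hc0 : c ≠ 0 := by rintro rfl; apply hb0; linarith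
    have hN : ((2 * c ^ 3) ^ 2 + (-(2 * c ^ 3)) ^ 2) ^ ((1 : ℝ) / 3) = 2 * c ^ 2 := by
      rw [← hcube (2 * c ^ 2) (by positivity)]; congr 1; ring
    refine ⟨2 * c ^ 3, -(2 * c ^ 3), ?_, by ring, ?_, ?_⟩
    · rintro ⟨h1, -⟩
      exact hc0 (by simpa using h1)
    · rw [hN]
      linear_combination (-2 * c ^ 2) * hc
    · rw [hN]
      have h1 : |c| * |α - β| = |b| := by rw [← abs_mul, hc, abs_neg]
      have h2 : |c| * η ≤ R := by
        have : |α - β| * (|c| * η) ≤ |α - β| * R := by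
          nlinarith [mul_nonneg hb hβ.le]
        exact le_of_mul_le_mul_left this hk
      have h3 : c ^ 2 * η ^ 2 ≤ R ^ 2 := by
        rw [← sq_abs c, ← mul_pow]; gcongr
      have h4 : η ^ 2 * (2 * c ^ 2) ≤ η ^ 2 * η := by nlinarith
      exact le_of_mul_le_mul_left h4 (by positivity)
  · have hNle : ∀ x ∈ Icc (-R) R, (x ^ 2 + (a - x) ^ 2) ^ ((1 : ℝ) / 3) ≤ η := by
      intro x hx
      refine hcbrt _ (by positivity) ?_
      have h1 : |x| ≤ R := abs_le.2 hx
      have h2 : |a - x| ≤ 2 * R := (abs_sub a x).trans (by linarith)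
      have h3 : x ^ 2 ≤ R ^ 2 := sq_le_sq' hx.1 hx.2
      have h4 := abs_le.1 h2
      have h5 : (a - x) ^ 2 ≤ (2 * R) ^ 2 := sq_le_sq' h4.1 h4.2
      nlinarith
    have hmaps : MapsTo (fun x => -(β * a + b * (x ^ 2 + (a - x) ^ 2) ^ ((1 : ℝ) / 3)) / (α - β))
        (Icc (-R) R) (Icc (-R) R) := by
      intro x hx
      have hN0 : 0 ≤ (x ^ 2 + (a - x) ^ 2) ^ ((1 : ℝ) / 3) := by positivity
      refine abs_le.1 ?_
      rw [abs_div, abs_neg, div_le_iff₀ hk]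
      calc |β * a + b * (x ^ 2 + (a - x) ^ 2) ^ ((1 : ℝ) / 3)|
          ≤ β * |a| + |b| * (x ^ 2 + (a - x) ^ 2) ^ ((1 : ℝ) / 3) := by
            refine (abs_add_le _ _).trans_eq ?_
            rw [abs_mul, abs_mul, abs_of_pos hβ, abs_of_nonneg hN0]
        _ ≤ β * |a| + |b| * η := by gcongr; exact hNle x hx
        _ ≤ R * |α - β| := by nlinarith [mul_nonneg hb hβ.le, mul_nonneg ha hη.le]
    have hcont : Continuous fun x =>
        -(β * a + b * (x ^ 2 + (a - x) ^ 2) ^ ((1 : ℝ) / 3)) / (α - β) := by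
      have : Continuous fun x : ℝ => (x ^ 2 + (a - x) ^ 2) ^ ((1 : ℝ) / 3) :=
        Continuous.rpow_const (by fun_prop) fun _ => Or.inr (by norm_num)
      fun_prop
    obtain ⟨p, hp, hfix⟩ := exists_mem_Icc_isFixedPt_of_mapsTo hcont.continuousOn
      (by linarith) hmaps
    refine ⟨p, a - p, ?_, by ring, ?_, hNle p hp⟩
    · rintro ⟨h1, h2⟩
      exact ha0 (by linarith)
    · have h1 : -(β * a + b * (p ^ 2 + (a - p) ^ 2) ^ ((1 : ℝ) / 3)) / (α - β) = p := hfix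
      rw [div_eq_iff (sub_ne_zero.2 hne)] at h1
      linear_combination h1

/-- Along the linear flow, the speed of the time change decays exponentially, so its primitive is
bounded. -/
theorem integral_planar_speed_le {α β γ p q : ℝ} (hγ : 0 < γ) (hα : γ ≤ α) (hβ : γ ≤ β) (s : ℝ) :
    ∫ x in (0 : ℝ)..s,
        ((p * Real.exp (-α * x)) ^ 2 + (q * Real.exp (-β * x)) ^ 2) ^ ((1 : ℝ) / 3) ≤
      (p ^ 2 + q ^ 2) ^ ((1 : ℝ) / 3) * (3 / (2 * γ)) := by
  have hc : Continuous fun x =>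
      ((p * Real.exp (-α * x)) ^ 2 + (q * Real.exp (-β * x)) ^ 2) ^ ((1 : ℝ) / 3) :=
    Continuous.rpow_const (by fun_prop) fun _ => Or.inr (by norm_num)
  set N := (p ^ 2 + q ^ 2) ^ ((1 : ℝ) / 3) with hN
  have hN0 : 0 ≤ N := by positivity
  rcases le_total s 0 with hs | hs
  · rw [intervalIntegral.integral_symm]
    have : 0 ≤ ∫ x in s..0,
        ((p * Real.exp (-α * x)) ^ 2 + (q * Real.exp (-β * x)) ^ 2) ^ ((1 : ℝ) / 3) :=
      intervalIntegral.integral_nonneg hs fun x _ => by positivity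
    have h2 : 0 ≤ N * (3 / (2 * γ)) := by positivity
    linarith
  have hexp : ∀ x : ℝ, HasDerivAt (fun x => -(N * (3 / (2 * γ))) * Real.exp (-(2 * γ / 3) * x))
      (N * Real.exp (-(2 * γ / 3) * x)) x := by
    intro x
    have h1 : HasDerivAt (fun x => -(2 * γ / 3) * x) (-(2 * γ / 3)) x := by
      simpa using (hasDerivAt_id x).const_mul (-(2 * γ / 3))
    refine (h1.exp.const_mul (-(N * (3 / (2 * γ))))).congr_deriv ?_
    field_simp
  have hint := intervalIntegral.integral_eq_sub_of_hasDerivAt (a := 0) (b := s)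
    (fun x _ => hexp x) (Continuous.intervalIntegrable (by fun_prop) _ _)
  calc ∫ x in (0 : ℝ)..s,
        ((p * Real.exp (-α * x)) ^ 2 + (q * Real.exp (-β * x)) ^ 2) ^ ((1 : ℝ) / 3)
      ≤ ∫ x in (0 : ℝ)..s, N * Real.exp (-(2 * γ / 3) * x) := by
        refine intervalIntegral.integral_mono_on hs (hc.intervalIntegrable _ _)
          (Continuous.intervalIntegrable (by fun_prop) _ _) fun x hx => ?_
        have h1 : Real.exp (-(2 * γ / 3) * x) = (Real.exp (-γ * x) ^ 2) ^ ((1 : ℝ) / 3) := by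
          rw [← Real.exp_nat_mul, ← Real.exp_mul]; congr 1; push_cast; ring
        rw [h1, hN, ← Real.mul_rpow (by positivity) (by positivity)]
        refine Real.rpow_le_rpow (by positivity) ?_ (by norm_num)
        have h2 : Real.exp (-α * x) ≤ Real.exp (-γ * x) :=
          Real.exp_le_exp.2 (by nlinarith [hx.1])
        have h3 : Real.exp (-β * x) ≤ Real.exp (-γ * x) :=
          Real.exp_le_exp.2 (by nlinarith [hx.1])
        rw [mul_pow, mul_pow, add_mul]
        gcongr
    _ ≤ N * (3 / (2 * γ)) := by
        rw [hint]
        have : 0 ≤ N * (3 / (2 * γ)) * Real.exp (-(2 * γ / 3) * s) := by positivity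
        simp only [mul_zero, Real.exp_zero]
        linarith

/-- The planar system reaches the origin in finite time from every nonzero initial state. -/
theorem exists_planar_solution {α β γ p q : ℝ} (hγ : 0 < γ) (hα : γ ≤ α) (hβ : γ ≤ β)
    (hpq : ¬(p = 0 ∧ q = 0)) :
    ∃ (T : ℝ) (φ ψ : ℝ → ℝ), T ≤ (p ^ 2 + q ^ 2) ^ ((1 : ℝ) / 3) * (3 / (2 * γ)) ∧
      Continuous φ ∧ Continuous ψ ∧ φ 0 = p ∧ ψ 0 = q ∧
      (∀ t < T,
        HasDerivAt φ (-α * φ t / (φ t ^ 2 + ψ t ^ 2) ^ ((1 : ℝ) / 3)) t ∧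
        HasDerivAt ψ (-β * ψ t / (φ t ^ 2 + ψ t ^ 2) ^ ((1 : ℝ) / 3)) t) ∧
      ∀ t, T ≤ t → φ t = 0 ∧ ψ t = 0 := by
  have hα0 := hγ.trans_le hα
  have hβ0 := hγ.trans_le hβ
  set M : ℝ → ℝ := fun x =>
    ((p * Real.exp (-α * x)) ^ 2 + (q * Real.exp (-β * x)) ^ 2) ^ ((1 : ℝ) / 3) with hM
  have hMc : Continuous M :=
    Continuous.rpow_const (by fun_prop) fun _ => Or.inr (by norm_num)
  have hMpos : ∀ s, 0 < M s := fun s =>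
    Real.rpow_pos_of_pos (planar_norm_pos (by simpa using hpq)) _
  have hlow : ∀ s ≤ 0, (p ^ 2 + q ^ 2) ^ ((1 : ℝ) / 3) ≤ M s := by
    intro s hs
    refine Real.rpow_le_rpow (by positivity) ?_ (by norm_num)
    have h1 : 1 ≤ Real.exp (-α * s) := Real.one_le_exp (by nlinarith)
    have h2 : 1 ≤ Real.exp (-β * s) := Real.one_le_exp (by nlinarith)
    rw [mul_pow, mul_pow]
    exact add_le_add (le_mul_of_one_le_right (sq_nonneg _) (one_le_pow₀ h1))
      (le_mul_of_one_le_right (sq_nonneg _) (one_le_pow₀ h2))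
  obtain ⟨T, S, hT, hTB, hS0, hS, hSlim⟩ := exists_time_change hMc hMpos
    (Real.rpow_pos_of_pos (planar_norm_pos hpq) _) hlow
    (integral_planar_speed_le hγ hα hβ)
  have hevent : ∀ (r k t : ℝ), t < T →
      (fun t => if t < T then r * Real.exp (-k * S t) else 0) =ᶠ[𝓝 t]
        fun t => r * Real.exp (-k * S t) := by
    intro r k t ht
    filter_upwards [Iio_mem_nhds ht] with u hu
    exact if_pos hu
  have hderiv : ∀ (r k t : ℝ), t < T →
      HasDerivAt (fun t => if t < T then r * Real.exp (-k * S t) else 0)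
        (-k * (r * Real.exp (-k * S t)) / M (S t)) t := by
    intro r k t ht
    have h1 := (((hS t ht).const_mul (-k)).exp.const_mul r).congr_of_eventuallyEq (hevent r k t ht)
    exact h1.congr_deriv (by ring)
  have hcont : ∀ r k : ℝ, 0 < k →
      Continuous fun t => if t < T then r * Real.exp (-k * S t) else 0 := by
    intro r k hk
    refine continuous_iff_continuousAt.2 fun t => ?_
    rcases lt_trichotomy t T with ht | rfl | ht
    · exact (hderiv r k t ht).continuousAt
    · refine continuousAt_iff_continuous_left'_right'.2 ⟨?_, ?_⟩
      · have h1 : Tendsto (fun u => r * Real.exp (-k * S u)) (𝓝[<] t) (𝓝 0) := by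
          have h2 : Tendsto (fun u => -k * S u) (𝓝[<] t) atBot :=
            hSlim.const_mul_atTop_of_neg (neg_neg_of_pos hk)
          simpa using (Real.tendsto_exp_atBot.comp h2).const_mul r
        unfold ContinuousWithinAt
        beta_reduce
        rw [if_neg (lt_irrefl t)]
        refine h1.congr' ?_
        filter_upwards [self_mem_nhdsWithin] with u hu
        exact (if_pos hu).symm
      · unfold ContinuousWithinAt
        beta_reduce
        rw [if_neg (lt_irrefl t)]
        refine tendsto_const_nhds.congr' ?_
        filter_upwards [self_mem_nhdsWithin] with u hu
        exact (if_neg (not_lt_of_gt hu)).symm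
    · refine (continuousAt_const (y := (0 : ℝ))).congr ?_
      filter_upwards [Ioi_mem_nhds ht] with u hu
      exact (if_neg (not_lt_of_gt hu)).symm
  refine ⟨T, fun t => if t < T then p * Real.exp (-α * S t) else 0,
    fun t => if t < T then q * Real.exp (-β * S t) else 0, hTB, hcont p α hα0, hcont q β hβ0,
    by simp [hT, hS0], by simp [hT, hS0], fun t ht => ?_, fun t ht => ?_⟩
  · have h1 := hderiv p α t ht
    have h2 := hderiv q β t ht
    simp only [hM] at h1 h2
    simp only [if_pos ht]
    exact ⟨h1, h2⟩
  · simp [not_lt.2 ht]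

/-- Construction of the auxiliary scalar dynamics `ζ = φ + ψ`: for `α, β > 0` with
`α² + β² − 4αβ > 0` and any `δ > 0`, for all sufficiently small prescribed data
`(a, b)` there is a solution `(φ, ψ)` of the planar system
`φ′ = −αφ/(φ² + ψ²)^{1/3}`, `ψ′ = −βψ/(φ² + ψ²)^{1/3}` on `[0, ∞)` such that
`ζ := φ + ψ` is `C¹` on `[0, ∞)` with `ζ(0) = a`, `ζ′(0) = b`, and `φ`, `ψ`
(hence `ζ`) vanish for `t ≥ δ/2`. -/
theorem stmt14 (α β δ : ℝ) (hα : 0 < α) (hβ : 0 < β)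
    (h : α ^ 2 + β ^ 2 - 4 * (α * β) > 0) (hδ : 0 < δ) :
    ∃ ε > (0 : ℝ), ∀ a b : ℝ, |a| + |b| < ε →
      ∃ φ ψ : ℝ → ℝ,
        ContinuousOn φ (Set.Ici 0) ∧ ContinuousOn ψ (Set.Ici 0) ∧
        (∀ t : ℝ, 0 ≤ t → (φ t, ψ t) ≠ ((0 : ℝ), (0 : ℝ)) →
          HasDerivWithinAt φ
            (-α * φ t / ((φ t) ^ 2 + (ψ t) ^ 2) ^ ((1 : ℝ) / 3)) (Set.Ici 0) t ∧
          HasDerivWithinAt ψ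
            (-β * ψ t / ((φ t) ^ 2 + (ψ t) ^ 2) ^ ((1 : ℝ) / 3)) (Set.Ici 0) t) ∧
        (∃ ζ' : ℝ → ℝ, ContinuousOn ζ' (Set.Ici 0) ∧
          (∀ t : ℝ, 0 ≤ t →
            HasDerivWithinAt (fun s => φ s + ψ s) (ζ' t) (Set.Ici 0) t) ∧
          ζ' 0 = b) ∧
        φ 0 + ψ 0 = a ∧
        (∀ t : ℝ, δ / 2 ≤ t → φ t = 0 ∧ ψ t = 0) := by
  have hne : α ≠ β := by
    rintro rfl
    nlinarith
  have hγ : 0 < min α β := lt_min hα hβ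
  obtain ⟨ε, hε, H⟩ := exists_planar_initial_state (η := δ * min α β / 3) hβ hne (by positivity)
  refine ⟨ε, hε, fun a b hab => ?_⟩
  by_cases hab0 : a = 0 ∧ b = 0
  · obtain ⟨rfl, rfl⟩ := hab0
    refine ⟨0, 0, continuousOn_const, continuousOn_const, fun t _ ht => absurd rfl ht,
      ⟨0, continuousOn_const, fun t _ => ?_, rfl⟩, by simp, fun t _ => ⟨rfl, rfl⟩⟩
    simpa using hasDerivWithinAt_const t (Set.Ici 0) (0 : ℝ)
  obtain ⟨p, q, hpq, hsum, hb, hN⟩ := H a b hab hab0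
  obtain ⟨T, φ, ψ, hT, hφ, hψ, hφ0, hψ0, hode, hzero⟩ :=
    exists_planar_solution hγ (min_le_left α β) (min_le_right α β) hpq
  have hTδ : T ≤ δ / 2 := by
    refine hT.trans ((mul_le_mul_of_nonneg_right hN (by positivity)).trans_eq ?_)
    field_simp
  have hζc : Continuous fun t =>
      (-α * φ t + -β * ψ t) / (φ t ^ 2 + ψ t ^ 2) ^ ((1 : ℝ) / 3) :=
    (continuous_planar_field (-α) (-β)).comp (hφ.prodMk hψ)
  have hζ_ne : ∀ t ≠ T, HasDerivAt (fun s => φ s + ψ s)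
      ((-α * φ t + -β * ψ t) / (φ t ^ 2 + ψ t ^ 2) ^ ((1 : ℝ) / 3)) t := by
    intro t ht
    rcases lt_or_gt_of_ne ht with ht | ht
    · rw [add_div]
      exact (hode t ht).1.add (hode t ht).2
    · obtain ⟨h1, h2⟩ := hzero t ht.le
      rw [h1, h2]
      simp only [mul_zero, add_zero, zero_div]
      refine (hasDerivAt_const t (0 : ℝ)).congr_of_eventuallyEq ?_
      filter_upwards [Ioi_mem_nhds ht] with u hu
      simp [hzero u (le_of_lt hu)]
  have hζ : ∀ t, HasDerivAt (fun s => φ s + ψ s)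
      ((-α * φ t + -β * ψ t) / (φ t ^ 2 + ψ t ^ 2) ^ ((1 : ℝ) / 3)) t := by
    intro t
    by_cases ht : t = T
    · subst ht
      exact hasDerivAt_of_hasDerivAt_of_ne hζ_ne (hφ.add hψ).continuousAt hζc.continuousAt
    · exact hζ_ne t ht
  refine ⟨φ, ψ, hφ.continuousOn, hψ.continuousOn, fun t _ ht => ?_,
    ⟨_, hζc.continuousOn, fun t _ => (hζ t).hasDerivWithinAt, ?_⟩, by rw [hφ0, hψ0, hsum],
    fun t ht => hzero t (hTδ.trans ht)⟩
  · have htT : t < T := by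
      by_contra! hle
      exact ht (Prod.ext (hzero t hle).1 (hzero t hle).2)
    exact ⟨(hode t htT).1.hasDerivWithinAt, (hode t htT).2.hasDerivWithinAt⟩
  · rw [hφ0, hψ0, div_eq_iff (Real.rpow_pos_of_pos (planar_norm_pos hpq) _).ne', ← hb]
    ring
end
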